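/- arXiv:1211.3708 — 4 statements merged into one kernel-verified Lean document; each statement's English description precedes it below -/
import Mathlib

section
/- For every integer N ≥ 2 there exists a pure f-vector (1, f_0, f_1, ..., f_e) that is nonunimodal with exactly N peaks. -/
/-- `macaulayBound i n` is the Macaulay upper bound `n^{<i>}`, computed greedily from
the `i`-binomial expansion of `n`:  if `n = C(n_i,i) + C(n_{i-1},i-1) + ⋯ + C(n_j,j)`
with `n_i > n_{i-1} > ⋯ > n_j ≥ j ≥ 1`, then
`n^{<i>} = C(n_i+1,i+1) + C(n_{i-1}+1,i) + ⋯ + C(n_j+1,j+1)`.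
By convention `macaulayBound 0 n = 0` and `macaulayBound i 0 = 0`. -/
def macaulayBound : ℕ → ℕ → ℕ
  | 0, _ => 0
  | _ + 1, 0 => 0
  | i + 1, n + 1 =>
      let m := Nat.findGreatest (fun m => Nat.choose m (i + 1) ≤ n + 1) (n + i + 2)
      Nat.choose (m + 1) (i + 2) + macaulayBound i (n + 1 - Nat.choose m (i + 1))

/-- `IsPeak L g i`: position `i` is a peak of the finite sequence `g 0, …, g (L-1)`:
the entry at `i` is strictly greater than the preceding entry (or `i` is the first
position) and strictly greater than the following entry (or `i` is the last position). -/
def IsPeak (L : ℕ) (g : ℕ → ℕ) (i : ℕ) : Prop :=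
  i < L ∧ (i = 0 ∨ g (i - 1) < g i) ∧ (i + 1 = L ∨ g (i + 1) < g i)

/-- `IsPureFVector e f`: `(1, f 0, …, f e)` is a pure f-vector, i.e. there are a finite
set `V` and a nonempty family `F` of `(e+1)`-element subsets of `V` such that, for each
`i ≤ e`, `f i` is the number of `(i+1)`-element subsets of `V` contained in at least one
member of `F`. -/
def IsPureFVector (e : ℕ) (f : ℕ → ℕ) : Prop :=
  ∃ (V : Finset ℕ) (F : Finset (Finset ℕ)), F.Nonempty ∧
    (∀ S ∈ F, S ⊆ V ∧ S.card = e + 1) ∧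
    ∀ i ≤ e, f i = ((V.powersetCard (i + 1)).filter (fun T => ∃ S ∈ F, T ⊆ S)).card

/-- The sequence `(1, f 0, f 1, …)` attached to an f-vector `f`. -/
def seqOf (f : ℕ → ℕ) : ℕ → ℕ := fun k => if k = 0 then 1 else f (k - 1)

open Polynomial

/-- `K` is a simplicial complex (containing the empty face) all of whose facets have `d`
vertices. -/
structure IsPureComplex {α : Type} (d : ℕ) (K : Finset (Finset α)) : Prop where
  empty_mem : ∅ ∈ K
  down_closed : ∀ S ∈ K, ∀ T ⊆ S, T ∈ K
  exists_facet : ∀ T ∈ K, ∃ S ∈ K, T ⊆ S ∧ S.card = d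

/-- The generating polynomial of the faces of `K`, graded by their number of vertices. -/
noncomputable def facePoly {α : Type} (K : Finset (Finset α)) : ℕ[X] :=
  ∑ T ∈ K, X ^ T.card

/-- `p` is the face polynomial of a pure complex whose facets have `d` vertices. -/
def IsPureFacePoly (d : ℕ) (p : ℕ[X]) : Prop :=
  ∃ (α : Type) (_ : Fintype α) (K : Finset (Finset α)), IsPureComplex d K ∧ facePoly K = p

theorem coeff_facePoly {α : Type} (K : Finset (Finset α)) (k : ℕ) :
    (facePoly K).coeff k = (K.filter (fun T => T.card = k)).card := by
  simp only [facePoly, finsetSum_coeff, coeff_X_pow, Finset.card_filter, eq_comm]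

theorem IsPureFacePoly.coeff_zero {d : ℕ} {p : ℕ[X]} (hp : IsPureFacePoly d p) :
    p.coeff 0 = 1 := by
  obtain ⟨α, _, K, hK, rfl⟩ := hp
  rw [coeff_facePoly, Finset.card_eq_one]
  refine ⟨∅, ?_⟩
  ext T
  simp only [Finset.mem_filter, Finset.card_eq_zero, Finset.mem_singleton]
  exact ⟨fun h => h.2, fun h => ⟨h ▸ hK.empty_mem, h⟩⟩

theorem isPureFacePoly_one : IsPureFacePoly 0 1 := by
  refine ⟨Empty, inferInstance, {∅}, ⟨by simp, ?_, by simp⟩, by simp [facePoly]⟩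
  intro S _ T _
  simp [Finset.eq_empty_of_isEmpty]

theorem isPureFacePoly_points {n : ℕ} (hn : 1 ≤ n) : IsPureFacePoly 1 (1 + C n * X) := by
  classical
  refine ⟨Fin n, inferInstance, insert ∅ (Finset.univ.image fun i => {i}),
    ⟨by simp, ?_, ?_⟩, ?_⟩
  · intro S hS T hT
    simp only [Finset.mem_insert, Finset.mem_image, Finset.mem_univ, true_and] at hS ⊢
    rcases hS with rfl | ⟨i, rfl⟩
    · exact Or.inl (Finset.subset_empty.1 hT)
    · rcases Finset.subset_singleton_iff.1 hT with h | h
      · exact Or.inl h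
      · exact Or.inr ⟨i, h.symm⟩
  · intro T hT
    simp only [Finset.mem_insert, Finset.mem_image, Finset.mem_univ, true_and] at hT
    rcases hT with rfl | ⟨i, rfl⟩
    · exact ⟨{⟨0, hn⟩}, by simp, by simp, by simp⟩
    · exact ⟨{i}, by simp, by simp, by simp⟩
  · rw [facePoly, Finset.sum_insert (by simp), Finset.sum_image (Finset.singleton_injective.injOn)]
    simp

/-- The join of two pure complexes is pure. -/
theorem IsPureFacePoly.mul {d d' : ℕ} {p q : ℕ[X]} (hp : IsPureFacePoly d p)
    (hq : IsPureFacePoly d' q) : IsPureFacePoly (d + d') (p * q) := by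
  classical
  obtain ⟨α, _, K, hK, rfl⟩ := hp
  obtain ⟨β, _, L, hL, rfl⟩ := hq
  have mem (T : Finset (α ⊕ β)) :
      T ∈ (K ×ˢ L).image (fun x => x.1.disjSum x.2) ↔ T.toLeft ∈ K ∧ T.toRight ∈ L := by
    simp only [Finset.mem_image, Finset.mem_product, Prod.exists]
    constructor
    · rintro ⟨A, B, h, rfl⟩
      simpa using h
    · intro h
      exact ⟨_, _, h, Finset.toLeft_disjSum_toRight⟩
  refine ⟨α ⊕ β, inferInstance, (K ×ˢ L).image (fun x => x.1.disjSum x.2), ⟨?_, ?_, ?_⟩, ?_⟩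
  · rw [mem]
    have hl : (∅ : Finset (α ⊕ β)).toLeft = ∅ := by ext; simp
    have hr : (∅ : Finset (α ⊕ β)).toRight = ∅ := by ext; simp
    exact ⟨hl ▸ hK.empty_mem, hr ▸ hL.empty_mem⟩
  · intro S hS T hT
    rw [mem] at hS ⊢
    exact ⟨hK.down_closed _ hS.1 _ (Finset.toLeft_subset_toLeft hT),
      hL.down_closed _ hS.2 _ (Finset.toRight_subset_toRight hT)⟩
  · intro T hT
    rw [mem] at hT
    obtain ⟨A, hA, hTA, hAd⟩ := hK.exists_facet _ hT.1
    obtain ⟨B, hB, hTB, hBd⟩ := hL.exists_facet _ hT.2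
    refine ⟨A.disjSum B, by rw [mem]; simpa using ⟨hA, hB⟩, ?_, by simp [hAd, hBd]⟩
    rw [← Finset.toLeft_disjSum_toRight (u := T)]
    exact Finset.disjSum_mono hTA hTB
  · rw [facePoly, Finset.sum_image, facePoly, facePoly, Finset.sum_mul_sum,
      Finset.sum_product]
    · simp [pow_add]
    · rintro ⟨A, B⟩ _ ⟨A', B'⟩ _ h
      have h1 := congrArg Finset.toLeft h
      have h2 := congrArg Finset.toRight h
      simp only [Finset.toLeft_disjSum, Finset.toRight_disjSum] at h1 h2
      rw [h1, h2]

theorem IsPureFacePoly.pow {p : ℕ[X]} (hp : IsPureFacePoly 1 p) (j : ℕ) :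
    IsPureFacePoly j (p ^ j) := by
  induction j with
  | zero => simpa using isPureFacePoly_one
  | succ j ih => rw [pow_succ]; exact ih.mul hp

theorem one_add_cancel {p q : ℕ[X]} (h : 1 + p = 1 + q) : p = q := by
  ext k
  simpa using congrArg (fun r => coeff r k) h

/-- The disjoint union of two pure complexes of the same dimension is pure. -/
theorem IsPureFacePoly.add {d : ℕ} {p q : ℕ[X]} (hp : IsPureFacePoly d (1 + p))
    (hq : IsPureFacePoly d (1 + q)) : IsPureFacePoly d (1 + (p + q)) := by
  classical
  obtain ⟨α, _, K, hK, hp⟩ := hp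
  obtain ⟨β, _, L, hL, hq⟩ := hq
  set K' : Finset (Finset (α ⊕ β)) :=
    (K.erase ∅).map ⟨fun S => S.map .inl, Finset.map_injective _⟩ with hK'
  set L' : Finset (Finset (α ⊕ β)) :=
    (L.erase ∅).map ⟨fun S => S.map .inr, Finset.map_injective _⟩ with hL'
  have memK (T : Finset α) (hT : T ∈ K) : T.map .inl ∈ insert ∅ (K' ∪ L') := by
    rcases eq_or_ne T ∅ with rfl | h
    · simp
    · refine Finset.mem_insert_of_mem (Finset.mem_union_left _ ?_)
      exact Finset.mem_map.2 ⟨T, by simp [h, hT], rfl⟩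
  have memL (T : Finset β) (hT : T ∈ L) : T.map .inr ∈ insert ∅ (K' ∪ L') := by
    rcases eq_or_ne T ∅ with rfl | h
    · simp
    · refine Finset.mem_insert_of_mem (Finset.mem_union_right _ ?_)
      exact Finset.mem_map.2 ⟨T, by simp [h, hT], rfl⟩
  have mem (T : Finset (α ⊕ β)) (hT : T ∈ insert ∅ (K' ∪ L')) :
      (∃ S ∈ K, T = S.map .inl) ∨ ∃ S ∈ L, T = S.map .inr := by
    rcases Finset.mem_insert.1 hT with rfl | hT
    · exact Or.inl ⟨∅, hK.empty_mem, by simp⟩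
    rcases Finset.mem_union.1 hT with hT | hT
    · obtain ⟨S, hS, rfl⟩ := Finset.mem_map.1 hT
      exact Or.inl ⟨S, Finset.mem_of_mem_erase hS, rfl⟩
    · obtain ⟨S, hS, rfl⟩ := Finset.mem_map.1 hT
      exact Or.inr ⟨S, Finset.mem_of_mem_erase hS, rfl⟩
  refine ⟨α ⊕ β, inferInstance, insert ∅ (K' ∪ L'), ⟨by simp, ?_, ?_⟩, ?_⟩
  · intro S hS T hT
    rcases mem S hS with ⟨U, hU, rfl⟩ | ⟨U, hU, rfl⟩
    · obtain ⟨W, hW, rfl⟩ := Finset.subset_map_iff.1 hT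
      exact memK W (hK.down_closed U hU W hW)
    · obtain ⟨W, hW, rfl⟩ := Finset.subset_map_iff.1 hT
      exact memL W (hL.down_closed U hU W hW)
  · intro T hT
    rcases mem T hT with ⟨U, hU, rfl⟩ | ⟨U, hU, rfl⟩
    · obtain ⟨S, hS, hUS, hd⟩ := hK.exists_facet U hU
      exact ⟨S.map .inl, memK S hS, Finset.map_subset_map.2 hUS, by simpa using hd⟩
    · obtain ⟨S, hS, hUS, hd⟩ := hL.exists_facet U hU
      exact ⟨S.map .inr, memL S hS, Finset.map_subset_map.2 hUS, by simpa using hd⟩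
  · have hdisj : Disjoint K' L' := by
      rw [Finset.disjoint_left]
      intro T h1 h2
      obtain ⟨A, hA, rfl⟩ := Finset.mem_map.1 h1
      obtain ⟨B, hB, hAB⟩ := Finset.mem_map.1 h2
      obtain ⟨a, ha⟩ := Finset.nonempty_iff_ne_empty.2 (Finset.ne_of_mem_erase hA)
      have : (Sum.inl a : α ⊕ β) ∈ B.map .inr :=
        (congrArg (Sum.inl a ∈ ·) hAB).mpr (Finset.mem_map_of_mem _ ha)
      simp at this
    have hp' : ∑ T ∈ K.erase ∅, (X : ℕ[X]) ^ T.card = p := by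
      rw [facePoly, ← Finset.add_sum_erase _ _ hK.empty_mem] at hp
      exact one_add_cancel (by simpa using hp)
    have hq' : ∑ T ∈ L.erase ∅, (X : ℕ[X]) ^ T.card = q := by
      rw [facePoly, ← Finset.add_sum_erase _ _ hL.empty_mem] at hq
      exact one_add_cancel (by simpa using hq)
    rw [facePoly, Finset.sum_insert (by simp [hK', hL']), Finset.sum_union hdisj, hK', hL',
      Finset.sum_map, Finset.sum_map]
    simp [hp', hq']

theorem IsPureFacePoly.add_nsmul {d : ℕ} {p q : ℕ[X]} (hp : IsPureFacePoly d (1 + p))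
    (hq : IsPureFacePoly d (1 + q)) (M : ℕ) : IsPureFacePoly d (1 + (p + M • q)) := by
  induction M with
  | zero => simpa using hp
  | succ M ih =>
    rw [succ_nsmul, ← add_assoc p]
    exact ih.add hq

theorem exists_eq_one_add {p : ℕ[X]} (hp : p.coeff 0 = 1) : ∃ q, p = 1 + q :=
  ⟨divX p * X, by simpa [hp, add_comm] using (divX_mul_X_add p).symm⟩

theorem IsPureFacePoly.exists_coeff_eq {d : ℕ} {p q : ℕ[X]} (hp : IsPureFacePoly d p)
    (hq : IsPureFacePoly d q) (M : ℕ) :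
    ∃ r, IsPureFacePoly d r ∧ ∀ k ≠ 0, r.coeff k = p.coeff k + M * q.coeff k := by
  obtain ⟨p, rfl⟩ := exists_eq_one_add hp.coeff_zero
  obtain ⟨q, rfl⟩ := exists_eq_one_add hq.coeff_zero
  refine ⟨_, hp.add_nsmul hq M, fun k hk => ?_⟩
  simp [coeff_one, hk]

theorem IsPureFacePoly.isPureFVector {e : ℕ} {p : ℕ[X]} (hp : IsPureFacePoly (e + 1) p) :
    IsPureFVector e (fun i => p.coeff (i + 1)) := by
  classical
  obtain ⟨α, _, K, hK, rfl⟩ := hp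
  let φ : α ↪ ℕ := (Fintype.equivFin α).toEmbedding.trans Fin.valEmbedding
  refine ⟨Finset.univ.map φ, (K.filter fun S => S.card = e + 1).image (Finset.map φ),
    ?_, ?_, ?_⟩
  · obtain ⟨S, hS, -, hd⟩ := hK.exists_facet ∅ hK.empty_mem
    exact ⟨_, Finset.mem_image_of_mem _ (Finset.mem_filter.2 ⟨hS, hd⟩)⟩
  · intro S hS
    obtain ⟨T, hT, rfl⟩ := Finset.mem_image.1 hS
    exact ⟨Finset.map_subset_map.2 (Finset.subset_univ _), by
      simpa using (Finset.mem_filter.1 hT).2⟩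
  · intro i _
    change (facePoly K).coeff (i + 1) = _
    rw [coeff_facePoly, ← Finset.card_image_of_injective _ (Finset.map_injective φ)]
    congr 1
    ext T
    simp only [Finset.mem_image, Finset.mem_filter, Finset.mem_powersetCard]
    constructor
    · rintro ⟨U, ⟨hU, hc⟩, rfl⟩
      obtain ⟨S, hS, hUS, hd⟩ := hK.exists_facet U hU
      exact ⟨⟨Finset.map_subset_map.2 (Finset.subset_univ _), by simpa using hc⟩,
        S.map φ, ⟨S, ⟨hS, hd⟩, rfl⟩, Finset.map_subset_map.2 hUS⟩
    · rintro ⟨⟨-, hc⟩, _, ⟨S, ⟨hS, -⟩, rfl⟩, hT⟩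
      obtain ⟨U, hU, rfl⟩ := Finset.subset_map_iff.1 hT
      exact ⟨U, ⟨hK.down_closed S hS U hU, by simpa using hc⟩, rfl⟩

theorem exists_coeff_le (h : ℕ[X]) : ∃ B, ∀ k, h.coeff k ≤ B := by
  refine ⟨∑ i ∈ h.support, h.coeff i, fun k => ?_⟩
  by_cases hk : k ∈ h.support
  · exact Finset.single_le_sum (f := h.coeff) (fun _ _ => Nat.zero_le _) hk
  · simp [notMem_support_iff.1 hk]

/-- As `n` grows, `(1 + n X) ^ j * h` is `(n X) ^ j * h` up to an error of order `n ^ (j - 1)`. -/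
theorem exists_error_bound (h : ℕ[X]) (j : ℕ) :
    ∃ B, ∀ n ≥ 1, ∃ R : ℕ[X], (1 + C n * X) ^ j * h = n ^ j • (X ^ j * h) + R ∧
      ∀ k, n * R.coeff k ≤ B * n ^ j := by
  obtain ⟨H, hH⟩ := exists_coeff_le h
  induction j with
  | zero => exact ⟨0, fun n _ => ⟨0, by simp⟩⟩
  | succ j ih =>
    obtain ⟨B, hB⟩ := ih
    refine ⟨H + 2 * B, fun n hn => ?_⟩
    obtain ⟨R, hR, hRB⟩ := hB n hn
    refine ⟨n ^ j • (X ^ j * h) + (R + C n * (X * R)), ?_, fun k => ?_⟩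
    · have hC : (C n : ℕ[X]) = (n : ℕ[X]) := C_eq_natCast n
      rw [pow_succ', mul_assoc, hR, hC]
      simp only [nsmul_eq_mul, Nat.cast_pow]
      ring
    · have h1 : (X ^ j * h).coeff k ≤ H := by
        rw [coeff_X_pow_mul']
        split_ifs
        · exact hH _
        · exact Nat.zero_le _
      have h2 : n * (X * R).coeff k ≤ B * n ^ j := by
        cases k with
        | zero => simp
        | succ k => rw [coeff_X_mul]; exact hRB k
      have h3 := hRB k
      have h4 : B * n ^ j ≤ B * n ^ j * n := Nat.le_mul_of_pos_right _ hn
      have h5 := Nat.mul_le_mul_left (n * n ^ j) h1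
      have h6 := Nat.mul_le_mul_left n h2
      simp only [coeff_add, coeff_smul, coeff_C_mul, smul_eq_mul, pow_succ]
      nlinarith

theorem choose_lt_choose_succ {n k : ℕ} (h : 2 * k + 1 < n) :
    n.choose k < n.choose (k + 1) := by
  have h1 := Nat.choose_succ_right_eq n k
  have h2 : 0 < n.choose k := Nat.choose_pos (by omega)
  obtain ⟨c, hc⟩ := Nat.exists_eq_add_of_lt h
  rw [show n - k = (k + 1) + (c + 1) by omega] at h1
  nlinarith

theorem choose_succ_lt_choose {n k : ℕ} (h : n < 2 * k + 1) (hk : k ≤ n) :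
    n.choose (k + 1) < n.choose k := by
  have h1 := Nat.choose_succ_right_eq n k
  have h2 : 0 < n.choose k := Nat.choose_pos hk
  have h3 : n.choose k * (n - k) ≤ n.choose k * k := Nat.mul_le_mul_left _ (by omega)
  nlinarith

/-- Two-digit numbers in a large base are ordered lexicographically, even after adding small
errors. -/
theorem digits_lt {q m a b a' b' r r' B₁ B₂ : ℕ} (hq : 0 < q) (hm : B₁ + B₂ < m) (hb : b ≤ B₁)
    (hr : r ≤ B₂ * q) (h : a < a' ∨ a = a' ∧ b < b') :
    q * (m ^ 2 * a + m * b) + r < q * (m ^ 2 * a' + m * b') + r' := by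
  have hm1 : 1 ≤ m := by omega
  suffices m ^ 2 * a + m * b + B₂ < m ^ 2 * a' + m * b' by
    have := Nat.mul_lt_mul_of_pos_left this hq
    nlinarith
  rcases h with h | ⟨rfl, h⟩
  · have h1 : m ^ 2 * (a + 1) ≤ m ^ 2 * a' := Nat.mul_le_mul_left _ h
    nlinarith
  · have h1 : m * (b + 1) ≤ m * b' := Nat.mul_le_mul_left _ h
    nlinarith

/-- From a pure complex with facets of size `d`, one builds a pure complex with facets of size
`2 * d + 4` whose face numbers rise up to position `d + 2`, drop once, rise once, and then
reproduce the original pattern of rises and falls. -/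
theorem exists_shifted_pattern {d : ℕ} {h : ℕ[X]} (hh : IsPureFacePoly d h) :
    ∃ p, IsPureFacePoly (2 * d + 4) p ∧
      (∀ k < d + 2, p.coeff k < p.coeff (k + 1)) ∧
      p.coeff (d + 3) < p.coeff (d + 2) ∧ p.coeff (d + 3) < p.coeff (d + 4) ∧
      ∀ i l, h.coeff i < h.coeff l → p.coeff (d + 4 + i) < p.coeff (d + 4 + l) := by
  obtain ⟨B, hB⟩ := exists_error_bound h (d + 4)
  obtain ⟨m, hm⟩ : ∃ m, m = 2 ^ (2 * d + 4) + B + 1 := ⟨_, rfl⟩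
  have hm0 : 0 < m := hm ▸ Nat.succ_pos _
  have hm1 : 1 ≤ m ^ 2 := Nat.one_le_pow _ _ hm0
  obtain ⟨R, hR, hRB⟩ := hB (m ^ 2) hm1
  have h1 : IsPureFacePoly (2 * d + 4) ((1 + C (m ^ 2) * X) ^ (d + 4) * h) := by
    rw [show 2 * d + 4 = d + 4 + d by ring]
    exact ((isPureFacePoly_points hm1).pow _).mul hh
  have h2 : IsPureFacePoly (2 * d + 4) ((1 + X) ^ (2 * d + 4)) := by
    simpa using (isPureFacePoly_points le_rfl).pow (2 * d + 4)
  obtain ⟨q, hq⟩ : ∃ q, q = m ^ (2 * d + 6) := ⟨_, rfl⟩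
  have hq0 : 0 < q := hq ▸ Nat.pow_pos hm0
  obtain ⟨p, hp, hpc⟩ := h1.exists_coeff_eq h2 (q * m)
  obtain ⟨F, hF⟩ : ∃ F : ℕ → ℕ, ∀ k, F k =
    q * (m ^ 2 * (X ^ (d + 4) * h).coeff k + m * (2 * d + 4).choose k) + R.coeff k :=
    ⟨_, fun _ => rfl⟩
  have hpF (k : ℕ) (hk : k ≠ 0) : p.coeff k = F k := by
    rw [hpc k hk, hR, coeff_add, coeff_smul, add_comm 1 X, coeff_X_add_one_pow]
    simp only [hF, hq, smul_eq_mul, Nat.cast_id]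
    ring
  have hRq (k : ℕ) : R.coeff k ≤ B * q := by
    have := hRB k
    refine Nat.le_of_mul_le_mul_left (this.trans (le_of_eq ?_)) hm1
    rw [hq]; ring
  have key (k l : ℕ) (hkl : (X ^ (d + 4) * h).coeff k < (X ^ (d + 4) * h).coeff l ∨
      (X ^ (d + 4) * h).coeff k = (X ^ (d + 4) * h).coeff l ∧
        (2 * d + 4).choose k < (2 * d + 4).choose l) : F k < F l := by
    rw [hF, hF]
    exact digits_lt hq0 (by omega) (Nat.choose_le_two_pow _ _) (hRq k) hkl
  have low (k : ℕ) (hk : k < d + 4) : (X ^ (d + 4) * h).coeff k = 0 := by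
    rw [coeff_X_pow_mul', if_neg (by omega)]
  have high (i : ℕ) : (X ^ (d + 4) * h).coeff (d + 4 + i) = h.coeff i := by
    rw [add_comm (d + 4) i, coeff_X_pow_mul]
  refine ⟨p, hp, fun k hk => ?_, ?_, ?_, fun i l hil => ?_⟩
  · have hlt : F k < F (k + 1) :=
      key _ _ (Or.inr ⟨by rw [low _ (by omega), low _ (by omega)],
        choose_lt_choose_succ (by omega)⟩)
    rw [hpF (k + 1) (by omega)]
    rcases Nat.eq_zero_or_pos k with rfl | hk0
    · rw [hp.coeff_zero]
      refine lt_of_le_of_lt ?_ hlt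
      have : 1 ≤ q * (m ^ 2 * 0 + m * 1) := Nat.mul_pos hq0 (by omega)
      rw [hF, low 0 (by omega), Nat.choose_zero_right]
      exact Nat.le_add_right_of_le this
    · rwa [hpF k (by omega)]
  · rw [hpF _ (by omega), hpF _ (by omega)]
    exact key _ _ (Or.inr ⟨by rw [low _ (by omega), low _ (by omega)],
      choose_succ_lt_choose (by omega) (by omega)⟩)
  · rw [hpF _ (by omega), hpF _ (by omega)]
    refine key _ _ (Or.inl ?_)
    rw [low _ (by omega)]
    exact Nat.one_pos.trans_eq ((high 0).trans hh.coeff_zero).symm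
  · rw [hpF _ (by omega), hpF _ (by omega)]
    exact key _ _ (Or.inl (by rwa [high, high]))

theorem finite_setOf_isPeak (L : ℕ) (g : ℕ → ℕ) : {j | IsPeak L g j}.Finite :=
  (Set.finite_lt_nat L).subset fun _ hj => hj.1

theorem setOf_isPeak_shifted {d : ℕ} {h p : ℕ → ℕ} (hne : ∀ k < d, h k ≠ h (k + 1))
    (h1 : ∀ k < d + 2, p k < p (k + 1)) (h2 : p (d + 3) < p (d + 2))
    (h3 : p (d + 3) < p (d + 4))
    (h4 : ∀ i l, h i < h l → p (d + 4 + i) < p (d + 4 + l)) :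
    {j | IsPeak (2 * d + 4 + 1) p j} =
      insert (d + 2) ((fun i => d + 4 + i) '' {j | IsPeak (d + 1) h j}) := by
  have iff (i l : ℕ) (hil : h i ≠ h l) : p (d + 4 + i) < p (d + 4 + l) ↔ h i < h l :=
    ⟨fun hlt => by
      by_contra hcon
      exact absurd (h4 l i (by omega)) (by omega), h4 i l⟩
  ext j
  simp only [Set.mem_ofPred_eq, Set.mem_insert_iff, Set.mem_image]
  rcases lt_trichotomy j (d + 2) with hj | rfl | hj
  · have := h1 j hj
    constructor
    · rintro ⟨-, -, h | h⟩ <;> omega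
    · rintro (h | ⟨i, -, h⟩) <;> omega
  · exact ⟨fun _ => Or.inl rfl, fun _ => ⟨by omega, Or.inr (h1 (d + 1) (by omega)), Or.inr h2⟩⟩
  · rcases Nat.lt_or_ge j (d + 4) with hj' | hj'
    · obtain rfl : j = d + 3 := by omega
      constructor
      · rintro ⟨-, -, h | h⟩
        · omega
        · exact absurd h (by rw [show d + 3 + 1 = d + 4 by ring]; omega)
      · rintro (h | ⟨i, -, h⟩) <;> omega
    · obtain ⟨i, rfl⟩ := Nat.exists_eq_add_of_le hj'
      have hright (hi : i < d) : p (d + 4 + i + 1) < p (d + 4 + i) ↔ h (i + 1) < h i :=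
        iff (i + 1) i (hne i hi).symm
      have hleft (hi : i ≠ 0) (hid : i < d + 1) :
          p (d + 4 + i - 1) < p (d + 4 + i) ↔ h (i - 1) < h i := by
        obtain ⟨i, rfl⟩ := Nat.exists_eq_succ_of_ne_zero hi
        exact iff i (i + 1) (hne i (by omega))
      have hpeak : IsPeak (2 * d + 4 + 1) p (d + 4 + i) ↔ IsPeak (d + 1) h i := by
        unfold IsPeak
        by_cases hid : i < d + 1
        · refine and_congr (by omega) (and_congr ?_ ?_)
          · rcases eq_or_ne i 0 with rfl | hi
            · exact iff_of_true (Or.inr h3) (Or.inl rfl)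
            · rw [hleft hi hid]
              simp [hi]
          · rcases eq_or_ne i d with rfl | hi
            · exact iff_of_true (Or.inl (by omega)) (Or.inl rfl)
            · rw [hright (by omega)]
              exact or_congr_left (by omega)
        · exact iff_of_false (fun h => by omega) (fun h => by omega)
      rw [hpeak]
      constructor
      · exact fun h => Or.inr ⟨i, h, rfl⟩
      · rintro (h | ⟨l, hl, h⟩)
        · omega
        · rwa [← Nat.add_left_cancel h]

theorem exists_isPureFacePoly_ncard_peaks (N : ℕ) :
    ∃ (d : ℕ) (p : ℕ[X]), IsPureFacePoly d p ∧ (∀ k < d, p.coeff k ≠ p.coeff (k + 1)) ∧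
      {j | IsPeak (d + 1) p.coeff j}.ncard = N + 1 := by
  induction N with
  | zero =>
    refine ⟨0, 1, isPureFacePoly_one, by simp, ?_⟩
    rw [Set.ncard_eq_one]
    refine ⟨0, ?_⟩
    ext j
    simp only [IsPeak, Set.mem_ofPred_eq, Set.mem_singleton_iff]
    omega
  | succ N ih =>
    obtain ⟨d, h, hh, hne, hN⟩ := ih
    obtain ⟨p, hp, h1, h2, h3, h4⟩ := exists_shifted_pattern hh
    refine ⟨2 * d + 4, p, hp, fun k hk => ?_, ?_⟩
    · rcases Nat.lt_or_ge k (d + 4) with hk' | hk'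
      · rcases Nat.lt_or_ge k (d + 2) with hk2 | hk2
        · exact (h1 k hk2).ne
        · obtain rfl | rfl : k = d + 2 ∨ k = d + 3 := by omega
          · exact h2.ne'
          · exact h3.ne
      · obtain ⟨i, rfl⟩ := Nat.exists_eq_add_of_le hk'
        rcases lt_or_gt_of_ne (hne i (by omega)) with hlt | hlt
        · exact (h4 i (i + 1) hlt).ne
        · exact (h4 (i + 1) i hlt).ne'
    · rw [setOf_isPeak_shifted hne h1 h2 h3 h4,
        Set.ncard_insert_of_notMem ?_ ((finite_setOf_isPeak _ _).image _),
        Set.ncard_image_of_injective _ (add_right_injective _), hN]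
      rintro ⟨i, -, hi⟩
      simp only at hi
      omega

/-- For every integer `N ≥ 2` there exists a pure f-vector `(1, f 0, …, f e)` that is
nonunimodal with exactly `N` peaks. -/
theorem pure_fvector_arbitrarily_many_peaks (N : ℕ) (hN : 2 ≤ N) :
    ∃ (e : ℕ) (f : ℕ → ℕ), IsPureFVector e f ∧
      {j | IsPeak (e + 2) (seqOf f) j}.ncard = N := by
  obtain ⟨d, p, hp, -, hpN⟩ := exists_isPureFacePoly_ncard_peaks (N - 1)
  rw [Nat.sub_add_cancel (by omega)] at hpN
  obtain _ | e := d
  · have hsub : {j | IsPeak (0 + 1) p.coeff j} ⊆ {0} := fun j hj => by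
      have := hj.1
      simp only [Set.mem_singleton_iff]
      omega
    have := Set.ncard_le_ncard hsub
    rw [hpN, Set.ncard_singleton] at this
    omega
  · refine ⟨e, fun i => p.coeff (i + 1), hp.isPureFVector, ?_⟩
    have hseq : seqOf (fun i => p.coeff (i + 1)) = p.coeff := by
      funext k
      cases k with
      | zero => simp [seqOf, hp.coeff_zero]
      | succ k => simp [seqOf]
    rw [hseq, hpN]
end

section
/- Fix any integer N ≥ 2, and let k_1, k_2, ..., k_N be positive integers with k_{i+1} ≥ k_i + 2 for all i = 1, ..., N-1 and k_1 ≥ k_N/2. Set e + 1 = k_N. Then there exists a pure f-vector f = (1, f_0, f_1, ..., f_e) such that for each i = 1, ..., N the entry f_{k_i - 1} is a peak of f; in particular f is nonunimodal. -/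
/-- Reed–Solomon codes: for at most `#K` evaluation points there is a code of dimension `k` over
the finite field `K` whose projection to any set `J` of coordinates has `#K ^ min #J k` words. -/
lemma exists_code_card_restrict (K : Type) [Field K] [Fintype K] [DecidableEq K] (d k : ℕ)
    (hd : d ≤ Fintype.card K) :
    ∃ code : (Fin k → K) → Fin d → K, ∀ J : Finset (Fin d),
      (Finset.univ.image (fun c (x : J) => code c x)).card = Fintype.card K ^ min J.card k := by
  classical
  obtain ⟨v⟩ : Nonempty (Fin d ↪ K) :=
    Function.Embedding.nonempty_of_card_le (by simpa using hd)
  let poly := (Polynomial.degreeLTEquiv K k).symm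
  refine ⟨fun c x => (poly c).1.eval (v x), fun J => ?_⟩
  have hv : Set.InjOn v (J : Set (Fin d)) := v.injective.injOn
  let E := Lagrange.funEquivDegreeLT hv
  have hE : ∀ p (x : J), E p x = p.1.eval (v x) := fun p x => rfl
  rcases le_total J.card k with h | h
  · have hsurj : Function.Surjective (fun c (x : J) => (poly c).1.eval (v x)) := by
      intro φ
      refine ⟨poly.symm ⟨(E.symm φ).1, Polynomial.degreeLT_mono h (E.symm φ).2⟩, ?_⟩
      funext x
      simp only [LinearEquiv.apply_symm_apply]
      rw [← hE, LinearEquiv.apply_symm_apply]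
    rw [Finset.image_univ_of_surjective hsurj, Finset.card_univ, min_eq_left h]
    simp
  · have hinj : Function.Injective (fun c (x : J) => (poly c).1.eval (v x)) := by
      intro c c' hcc
      have key : (⟨(poly c).1, Polynomial.degreeLT_mono h (poly c).2⟩ :
          Polynomial.degreeLT K J.card) =
          ⟨(poly c').1, Polynomial.degreeLT_mono h (poly c').2⟩ := by
        apply E.injective
        funext x
        exact congrFun hcc x
      have hval := congrArg Subtype.val key
      exact poly.injective (Subtype.ext hval)
    rw [Finset.card_image_of_injective _ hinj, Finset.card_univ, min_eq_right h]
    simp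

/-- A pure complex on any finite vertex type has a pure f-vector. -/
lemma isPureFVector_of_fintype {α : Type} [Fintype α] [DecidableEq α] (e : ℕ)
    (F : Finset (Finset α)) (hF : F.Nonempty) (hcard : ∀ S ∈ F, S.card = e + 1) :
    IsPureFVector e (fun i =>
      ((Finset.univ.powersetCard (i + 1)).filter (fun T => ∃ S ∈ F, T ⊆ S)).card) := by
  classical
  let emb : α ↪ ℕ := (Fintype.equivFin α).toEmbedding.trans Fin.valEmbedding
  refine ⟨Finset.univ.map emb, F.image (Finset.map emb), hF.image _, ?_, ?_⟩
  · intro S hS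
    obtain ⟨U, hU, rfl⟩ := Finset.mem_image.1 hS
    exact ⟨Finset.map_subset_map.2 (Finset.subset_univ _), by simpa using hcard U hU⟩
  · intro i _
    beta_reduce
    rw [← Finset.card_image_of_injective _ (Finset.map_injective emb)]
    congr 1
    ext T
    simp only [Finset.mem_image, Finset.mem_filter, Finset.mem_powersetCard]
    constructor
    · rintro ⟨U, ⟨⟨_, hU⟩, S, hS, hUS⟩, rfl⟩
      exact ⟨⟨Finset.map_subset_map.2 (Finset.subset_univ _), by simpa using hU⟩,
        _, ⟨S, hS, rfl⟩, Finset.map_subset_map.2 hUS⟩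
    · rintro ⟨⟨_, hT⟩, _, ⟨S, hS, rfl⟩, hTS⟩
      obtain ⟨U, hU, rfl⟩ := Finset.subset_map_iff.1 hTS
      exact ⟨U, ⟨⟨Finset.subset_univ _, by simpa using hT⟩, S, hS, hU⟩, rfl⟩

/-- The disjoint union of the complexes of graphs of Reed–Solomon codewords of dimensions `κ t`. -/
lemma isPureFVector_sum_pow (K : Type) [Field K] [Fintype K] {ι : Type} [Fintype ι] [Nonempty ι]
    (κ : ι → ℕ) (e : ℕ) (he : e + 1 ≤ Fintype.card K) :
    IsPureFVector e (fun i =>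
      (e + 1).choose (i + 1) * ∑ t, Fintype.card K ^ min (i + 1) (κ t)) := by
  classical
  choose code hcode using fun t => exists_code_card_restrict K (e + 1) (κ t) he
  let face (t : ι) (c : Fin (κ t) → K) (J : Finset (Fin (e + 1))) :
      Finset (Fin (e + 1) × ι × K) := J.image (fun x => (x, t, code t c x))
  have hinj (t : ι) (c : Fin (κ t) → K) :
      Function.Injective (fun x => (x, t, code t c x)) := fun x y h => congrArg Prod.fst h
  have hfst (t c J) : (face t c J).image Prod.fst = J := by
    simp [face, Finset.image_image, Function.comp_def]
  let F : Finset (Finset (Fin (e + 1) × ι × K)) :=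
    Finset.univ.biUnion (fun t => Finset.univ.image (fun c => face t c Finset.univ))
  have hF : ∀ S, S ∈ F ↔ ∃ t c, face t c Finset.univ = S := by simp [F]
  have hne : F.Nonempty := by
    obtain ⟨t⟩ := ‹Nonempty ι›
    exact ⟨face t 0 Finset.univ, (hF _).2 ⟨t, 0, rfl⟩⟩
  have hcardF : ∀ S ∈ F, S.card = e + 1 := by
    intro S hS
    obtain ⟨t, c, rfl⟩ := (hF S).1 hS
    simp [face, Finset.card_image_of_injective _ (hinj t c)]
  convert isPureFVector_of_fintype e F hne hcardF using 1
  funext i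
  have hfaces : (Finset.univ.powersetCard (i + 1)).filter (fun T => ∃ S ∈ F, T ⊆ S) =
      (Finset.univ ×ˢ Finset.univ.powersetCard (i + 1)).biUnion
        (fun tJ : ι × Finset (Fin (e + 1)) =>
          Finset.univ.image (fun c => face tJ.1 c tJ.2)) := by
    ext T
    simp only [Finset.mem_filter, Finset.mem_powersetCard, Finset.subset_univ, true_and,
      Finset.mem_biUnion, Finset.mem_product, Finset.mem_univ, Finset.mem_image, Prod.exists]
    constructor
    · rintro ⟨hT, S, hS, hTS⟩
      obtain ⟨t, c, rfl⟩ := (hF S).1 hS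
      obtain ⟨J, _, rfl⟩ := Finset.subset_image_iff.1 hTS
      refine ⟨t, J, ?_, c, rfl⟩
      rwa [Finset.card_image_of_injective _ (hinj t c)] at hT
    · rintro ⟨t, J, hJ, c, rfl⟩
      refine ⟨?_, _, (hF _).2 ⟨t, c, rfl⟩, Finset.image_subset_image (Finset.subset_univ _)⟩
      rw [Finset.card_image_of_injective _ (hinj t c), hJ]
  rw [hfaces, Finset.card_biUnion]
  · have hcard (t : ι) (J : Finset (Fin (e + 1))) :
        (Finset.univ.image (fun c => face t c J)).card = Fintype.card K ^ min J.card (κ t) := by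
      let graph : (J → K) → Finset (Fin (e + 1) × ι × K) :=
        fun φ => Finset.univ.image (fun x : J => (x.1, t, φ x))
      have hgraph : Function.Injective graph := by
        intro φ ψ h
        funext x
        have hx : (x.1, t, φ x) ∈ graph ψ := h ▸ Finset.mem_image_of_mem _ (Finset.mem_univ x)
        obtain ⟨y, _, hy⟩ := Finset.mem_image.1 hx
        simp only [Prod.mk.injEq, true_and] at hy
        rw [← hy.2, Subtype.ext hy.1]
      have hface : (fun c => face t c J) = graph ∘ (fun c (x : J) => code t c x) := by
        funext c
        ext y
        simp [face, graph]
      rw [hface, ← Finset.image_image, Finset.card_image_of_injective _ hgraph, hcode]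
    rw [Finset.sum_product, Finset.mul_sum]
    refine Finset.sum_congr rfl fun t _ => ?_
    rw [Finset.sum_congr rfl (g := fun _ => Fintype.card K ^ min (i + 1) (κ t))]
    · simp
    · intro J hJ
      rw [hcard, (Finset.mem_powersetCard.1 hJ).2]
  · rintro ⟨t, J⟩ hJ ⟨t', J'⟩ _ hne
    refine Finset.disjoint_left.2 fun U hU hU' => hne ?_
    obtain ⟨c, _, rfl⟩ := Finset.mem_image.1 hU
    obtain ⟨c', _, h⟩ := Finset.mem_image.1 hU'
    have hJJ : J' = J := by
      simpa only [hfst] using congrArg (Finset.image Prod.fst) h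
    have hJc : J.card = i + 1 := by simpa using hJ
    obtain ⟨x, hx⟩ := Finset.card_pos.1 (by omega : 0 < J.card)
    have hmem : (x, t, code t c x) ∈ face t' c' J' := h ▸ Finset.mem_image_of_mem _ hx
    obtain ⟨y, _, hy⟩ := Finset.mem_image.1 hmem
    simp only [Prod.mk.injEq] at hy
    rw [hJJ, hy.2.1]

lemma add_two_mul_sub_le {N : ℕ} {k : ℕ → ℕ} (hgap : ∀ i, 1 ≤ i → i < N → k i + 2 ≤ k (i + 1))
    {i m : ℕ} (hi : 1 ≤ i) (him : i ≤ m) (hm : m ≤ N) : k i + 2 * (m - i) ≤ k m := by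
  induction m, him using Nat.le_induction with
  | base => simp
  | succ n hn ih =>
    have h₁ := ih (by omega)
    have h₂ := hgap n (by omega) (by omega)
    omega

/-- The weight of the faces with `j` vertices in a union of `s ^ (2 * (k N - k i) + i)` copies of
the Reed–Solomon complex of dimension `k i` over a field with `s ^ 2` elements. -/
def peakWeight (N s : ℕ) (k : ℕ → ℕ) (j : ℕ) : ℕ :=
  ∑ i ∈ Finset.Icc 1 N, s ^ (2 * (k N - k i) + i) * (s ^ 2) ^ min j (k i)

section

variable {N s m : ℕ} {k : ℕ → ℕ}

lemma pow_le_peakWeight (hgap : ∀ i, 1 ≤ i → i < N → k i + 2 ≤ k (i + 1))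
    (hm : 1 ≤ m) (hmN : m ≤ N) : s ^ (2 * k N + m) ≤ peakWeight N s k (k m) := by
  have hk := add_two_mul_sub_le hgap hm hmN le_rfl
  have hterm : s ^ (2 * k N + m) = s ^ (2 * (k N - k m) + m) * (s ^ 2) ^ min (k m) (k m) := by
    rw [← pow_mul, ← pow_add, min_self]
    congr 1
    omega
  rw [hterm]
  exact Finset.single_le_sum
    (f := fun i => s ^ (2 * (k N - k i) + i) * (s ^ 2) ^ min (k m) (k i))
    (fun _ _ => Nat.zero_le _) (Finset.mem_Icc.2 ⟨hm, hmN⟩)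

lemma peakWeight_pred_le (hs : 1 ≤ s) (hgap : ∀ i, 1 ≤ i → i < N → k i + 2 ≤ k (i + 1))
    (hm : 1 ≤ m) (hmN : m ≤ N) (hkm : 1 ≤ k m) :
    peakWeight N s k (k m - 1) ≤ N * s ^ (2 * k N + m - 1) := by
  refine (Finset.sum_le_card_nsmul _ _ (s ^ (2 * k N + m - 1)) fun i hi => ?_).trans (by simp)
  obtain ⟨hi, hiN⟩ := Finset.mem_Icc.1 hi
  rw [← pow_mul, ← pow_add]
  refine Nat.pow_le_pow_right hs ?_
  have hk := add_two_mul_sub_le hgap hi hiN le_rfl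
  rcases lt_or_ge i m with h | h
  · have := add_two_mul_sub_le hgap hi h.le hmN
    rw [min_eq_right (by omega)]
    omega
  · have := add_two_mul_sub_le hgap hm h hiN
    rw [min_eq_left (by omega)]
    omega

lemma peakWeight_succ_le (hs : 1 ≤ s) (hgap : ∀ i, 1 ≤ i → i < N → k i + 2 ≤ k (i + 1))
    (hm : 1 ≤ m) (hmN : m ≤ N) :
    peakWeight N s k (k m + 1) ≤ peakWeight N s k (k m) + N * s ^ (2 * k N + m - 1) := by
  have hconst : N * s ^ (2 * k N + m - 1) =
      ∑ _i ∈ Finset.Icc 1 N, s ^ (2 * k N + m - 1) := by simp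
  rw [hconst, peakWeight, peakWeight, ← Finset.sum_add_distrib]
  refine Finset.sum_le_sum fun i hi => ?_
  obtain ⟨hi, hiN⟩ := Finset.mem_Icc.1 hi
  have hk := add_two_mul_sub_le hgap hi hiN le_rfl
  rcases le_or_gt i m with h | h
  · have := add_two_mul_sub_le hgap hi h hmN
    rw [min_eq_right (by omega), min_eq_right (by omega)]
    exact Nat.le_add_right _ _
  · have := add_two_mul_sub_le hgap hm h.le hiN
    refine le_add_left ?_
    rw [← pow_mul, ← pow_add]
    exact Nat.pow_le_pow_right hs (by omega)

end

lemma choose_succ_lt_choose_s2 {d j : ℕ} (hj : j ≤ d) (h : d ≤ 2 * j) :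
    d.choose (j + 1) < d.choose j := by
  have h₁ := Nat.choose_succ_right_eq d j
  have h₂ := Nat.choose_pos hj
  have h₃ : d.choose j * (d - j) < d.choose j * (j + 1) :=
    Nat.mul_lt_mul_of_pos_left (by omega) h₂
  rw [← h₁] at h₃
  exact lt_of_mul_lt_mul_right h₃ (Nat.zero_le _)

lemma exists_valley_of_peaks {g : ℕ → ℕ} {p q : ℕ} (hpq : p + 2 ≤ q) (hp : g (p + 1) < g p)
    (hq : g (q - 1) < g q) : ∃ a b c, a < b ∧ b < c ∧ c ≤ q ∧ g b < g a ∧ g b < g c := by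
  by_cases h : g (p + 1) < g q
  · exact ⟨p, p + 1, q, by omega, by omega, le_rfl, hp, h⟩
  · exact ⟨p, q - 1, q, by omega, by omega, le_rfl, by omega, hq⟩

/-- Fix `N ≥ 2` and positive integers `k 1, …, k N` with `k (i+1) ≥ k i + 2` and
`k 1 ≥ k N / 2` (i.e. `2 * k 1 ≥ k N`).  With `e + 1 = k N`, there exists a pure
f-vector `f = (1, f 0, …, f e)` having a peak at the entry `f (k i - 1)` (which sits at
position `k i` of the sequence) for each `i = 1, …, N`; in particular `f` is
nonunimodal. -/
theorem pure_fvector_peaks_at_prescribed_positions (N : ℕ) (hN : 2 ≤ N) (k : ℕ → ℕ)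
    (hpos : ∀ i, 1 ≤ i → i ≤ N → 1 ≤ k i)
    (hgap : ∀ i, 1 ≤ i → i < N → k i + 2 ≤ k (i + 1))
    (hhalf : k N ≤ 2 * k 1) :
    ∃ f : ℕ → ℕ, IsPureFVector (k N - 1) f ∧
      (∀ i, 1 ≤ i → i ≤ N → IsPeak (k N + 1) (seqOf f) (k i)) ∧
      ∃ a b c, a < b ∧ b < c ∧ c ≤ k N ∧
        seqOf f b < seqOf f a ∧ seqOf f b < seqOf f c := by
  classical
  have hmono {i m : ℕ} (hi : 1 ≤ i) (him : i ≤ m) (hm : m ≤ N) := add_two_mul_sub_le hgap hi him hm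
  have hk₁ := hmono le_rfl (by omega : 1 ≤ N) le_rfl
  obtain ⟨s, hs, hprime⟩ := Nat.exists_infinite_primes (2 ^ k N * N + 1)
  have hs₁ : 1 ≤ s := hprime.one_le
  have : Fact s.Prime := ⟨hprime⟩
  let : Fintype (GaloisField s 2) := Fintype.ofFinite _
  have hq : Fintype.card (GaloisField s 2) = s ^ 2 := by
    rw [← Nat.card_eq_fintype_card, GaloisField.card s 2 two_ne_zero]
  have hcard : k N - 1 + 1 ≤ Fintype.card (GaloisField s 2) := by
    have h₁ : k N < 2 ^ k N := Nat.lt_two_pow_self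
    have h₂ : 2 ^ k N ≤ 2 ^ k N * N := Nat.le_mul_of_pos_right _ (by omega)
    have h₃ : s ≤ s ^ 2 := Nat.le_self_pow two_ne_zero s
    omega
  let a : ℕ → ℕ := fun i => s ^ (2 * (k N - k i) + i)
  have : Nonempty (Σ i : Finset.Icc 1 N, Fin (a i)) :=
    ⟨⟨⟨1, Finset.mem_Icc.2 ⟨le_rfl, by omega⟩⟩, ⟨0, Nat.pow_pos hs₁⟩⟩⟩
  have hpure := isPureFVector_sum_pow (GaloisField s 2)
    (fun t : Σ i : Finset.Icc 1 N, Fin (a i) => k t.1) (k N - 1) hcard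
  let f : ℕ → ℕ := fun i => (k N).choose (i + 1) * peakWeight N s k (i + 1)
  have hf : IsPureFVector (k N - 1) f := by
    convert hpure using 1
    funext i
    rw [hq, Nat.sub_add_cancel (by omega), Fintype.sum_sigma]
    simp only [Finset.sum_const, Finset.card_univ, Fintype.card_fin, smul_eq_mul]
    rw [Finset.sum_coe_sort (Finset.Icc 1 N) (fun i' => a i' * (s ^ 2) ^ min (i + 1) (k i'))]
    rfl
  have hseq {j : ℕ} (hj : 1 ≤ j) : seqOf f j = (k N).choose j * peakWeight N s k j := by
    simp only [seqOf, f]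
    rw [if_neg (by omega), Nat.sub_add_cancel hj]
  have hsmall (m : ℕ) (hm : 1 ≤ m) (j : ℕ) :
      (k N).choose j * (N * s ^ (2 * k N + m - 1)) < s ^ (2 * k N + m) := by
    calc (k N).choose j * (N * s ^ (2 * k N + m - 1))
        ≤ 2 ^ k N * (N * s ^ (2 * k N + m - 1)) :=
          Nat.mul_le_mul_right _ (Nat.choose_le_two_pow _ _)
      _ = 2 ^ k N * N * s ^ (2 * k N + m - 1) := by ring
      _ < s * s ^ (2 * k N + m - 1) :=
          Nat.mul_lt_mul_of_pos_right (by omega) (Nat.pow_pos hs₁)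
      _ = s ^ (2 * k N + m) := by
          rw [← pow_succ']
          congr 1
          omega
  have hup (m : ℕ) (hm : 1 ≤ m) (hmN : m ≤ N) : seqOf f (k m - 1) < seqOf f (k m) := by
    have h₁ := hmono le_rfl hm hmN
    have h₂ := hmono hm hmN le_rfl
    rw [hseq (by omega), hseq (by omega)]
    calc (k N).choose (k m - 1) * peakWeight N s k (k m - 1)
        ≤ (k N).choose (k m - 1) * (N * s ^ (2 * k N + m - 1)) :=
          Nat.mul_le_mul_left _ (peakWeight_pred_le hs₁ hgap hm hmN (by omega))
      _ < s ^ (2 * k N + m) := hsmall m hm _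
      _ ≤ peakWeight N s k (k m) := pow_le_peakWeight hgap hm hmN
      _ ≤ (k N).choose (k m) * peakWeight N s k (k m) :=
          Nat.le_mul_of_pos_left _ (Nat.choose_pos (by omega))
  have hdown (m : ℕ) (hm : 1 ≤ m) (hmN : m ≤ N) : seqOf f (k m + 1) < seqOf f (k m) := by
    have h₁ := hmono le_rfl hm hmN
    have h₂ := hmono hm hmN le_rfl
    rw [hseq (by omega), hseq (by omega)]
    calc (k N).choose (k m + 1) * peakWeight N s k (k m + 1)
        ≤ (k N).choose (k m + 1) * (peakWeight N s k (k m) + N * s ^ (2 * k N + m - 1)) :=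
          Nat.mul_le_mul_left _ (peakWeight_succ_le hs₁ hgap hm hmN)
      _ = (k N).choose (k m + 1) * peakWeight N s k (k m) +
            (k N).choose (k m + 1) * (N * s ^ (2 * k N + m - 1)) := mul_add _ _ _
      _ < (k N).choose (k m + 1) * peakWeight N s k (k m) + peakWeight N s k (k m) :=
          Nat.add_lt_add_left ((hsmall m hm _).trans_le (pow_le_peakWeight hgap hm hmN)) _
      _ = ((k N).choose (k m + 1) + 1) * peakWeight N s k (k m) := by ring
      _ ≤ (k N).choose (k m) * peakWeight N s k (k m) :=
          Nat.mul_le_mul_right _ (choose_succ_lt_choose_s2 (by omega) (by omega))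
  refine ⟨f, hf, fun m hm hmN => ?_, ?_⟩
  · have := hmono hm hmN le_rfl
    exact ⟨by omega, Or.inr (hup m hm hmN), Or.inr (hdown m hm hmN)⟩
  · have hk₁₂ : k 1 + 2 ≤ k 2 := hgap 1 le_rfl (by omega)
    have hk₂ := hmono one_le_two hN le_rfl
    obtain ⟨a, b, c, hab, hbc, hc, hba, hbc'⟩ :=
      exists_valley_of_peaks hk₁₂ (hdown 1 le_rfl (by omega)) (hup 2 one_le_two hN)
    exact ⟨a, b, c, hab, hbc, by omega, hba, hbc'⟩
end

section
/- Let r ≥ 7 be an integer congruent to 1 or 3 modulo 6, and let b_0 be the smallest positive integer b such that (1, r-3, b - 2r + 3, (r-1)(r+6)/6 - b) is an O-sequence. Then for every integer b with b_0 ≤ b ≤ (r-1)(r+6)/6, the sequence (1, r, b, C(r,2)/3) is a pure f-vector. Moreover 0 < b_0 ≤ (r-1)(r+6)/6 < C(r,2) - 1, so together with the facts that (1, r, C(r,2), C(r,2)/3) is a pure f-vector and (1, r, C(r,2)-1, C(r,2)/3) is not, the Interval Property fails for pure f-vectors. -/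
/-- `IsOSeq3 h₁ h₂ h₃`: the sequence `(1, h₁, h₂, h₃)` of nonnegative integers is an
O-sequence, i.e. it satisfies Macaulay's growth condition `h_{i+1} ≤ h_i^{<i>}` for
`i = 1, 2`. -/
def IsOSeq3 (h1 h2 h3 : ℕ) : Prop :=
  h2 ≤ macaulayBound 1 h1 ∧ h3 ≤ macaulayBound 2 h2

open Finset in
/-- Coning off a graph `H` without isolated vertices and adding triangles of `H`. -/
theorem isPureFVector_cone {r : ℕ} (hr : 1 ≤ r) {H S : Finset (Finset ℕ)}
    (hH : H ⊆ powersetCard 2 (Ico 1 r)) (hne : H.Nonempty)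
    (hcov : ∀ k ∈ Ico 1 r, ∃ e ∈ H, k ∈ e)
    (hS : ∀ t ∈ S, t ∈ powersetCard 3 (Ico 1 r) ∧ powersetCard 2 t ⊆ H) :
    IsPureFVector 2
      (fun i => if i = 0 then r else if i = 1 then r - 1 + #H else #H + #S) := by
  have hH0 : ∀ e ∈ H, 0 ∉ e := fun e he h0 => by
    have := (mem_powersetCard.1 (hH he)).1 h0
    simp at this
  have hS0 : ∀ t ∈ S, 0 ∉ t := fun t ht h0 => by
    have := (mem_powersetCard.1 (hS t ht).1).1 h0
    simp at this
  have hsub : Ico 1 r ⊆ range r := fun x hx => by simp at hx ⊢; omega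
  have h0r : 0 ∈ range r := by simp; omega
  obtain ⟨F, hF⟩ : ∃ F : Finset (Finset ℕ), F = H.image (insert 0) ∪ S := ⟨_, rfl⟩
  have hFS : ∀ T ∈ F, T ⊆ range r ∧ T.card = 2 + 1 := by
    subst hF
    intro T hT
    rcases mem_union.1 hT with hT | hT
    · obtain ⟨e, he, rfl⟩ := mem_image.1 hT
      obtain ⟨h1, h2⟩ := mem_powersetCard.1 (hH he)
      exact ⟨insert_subset h0r (h1.trans hsub), by rw [card_insert_of_notMem (hH0 e he), h2]⟩
    · obtain ⟨h1, h2⟩ := mem_powersetCard.1 (hS T hT).1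
      exact ⟨h1.trans hsub, h2⟩
  have vertices : (powersetCard 1 (range r)).filter
      (fun T => ∃ A ∈ F, T ⊆ A) = powersetCard 1 (range r) := by
    subst hF
    refine filter_true_of_mem fun T hT => ?_
    obtain ⟨k, hk, rfl⟩ : ∃ k ∈ range r, T = {k} := by
      rw [mem_powersetCard, card_eq_one] at hT
      obtain ⟨h, k, rfl⟩ := hT
      exact ⟨k, by simpa using h, rfl⟩
    obtain ⟨e, he, hke⟩ : ∃ e ∈ H, k ∈ insert 0 e := by
      rcases Nat.eq_zero_or_pos k with rfl | hpos
      · obtain ⟨e, he⟩ := hne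
        exact ⟨e, he, mem_insert_self _ _⟩
      · obtain ⟨e, he, hke⟩ := hcov k (by simp at hk ⊢; omega)
        exact ⟨e, he, mem_insert_of_mem hke⟩
    exact ⟨insert 0 e, mem_union_left _ (mem_image_of_mem _ he), by simpa using hke⟩
  have edges : (powersetCard 2 (range r)).filter
      (fun T => ∃ A ∈ F, T ⊆ A)
      = (Ico 1 r).image (fun k => {0, k}) ∪ H := by
    subst hF
    ext T
    simp only [mem_filter, mem_union, mem_powersetCard, mem_image]
    constructor
    · rintro ⟨⟨hTr, hT2⟩, A, hA, hTA⟩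
      by_cases h0 : 0 ∈ T
      · left
        have h1 : #(T.erase 0) = 1 := by rw [card_erase_of_mem h0, hT2]
        obtain ⟨k, hk⟩ := card_eq_one.1 h1
        have hkT : k ∈ T.erase 0 := by rw [hk]; exact mem_singleton_self k
        have hkr := hTr (mem_of_mem_erase hkT)
        have hk0 := ne_of_mem_erase hkT
        refine ⟨k, by simp at hkr ⊢; omega, ?_⟩
        rw [← insert_erase h0, hk]
      · right
        rcases hA with ⟨e, he, rfl⟩ | hA
        · have h1 : T ⊆ e := (subset_insert_iff_of_notMem h0).1 hTA
          rwa [eq_of_subset_of_card_le h1 (by rw [hT2, (mem_powersetCard.1 (hH he)).2])]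
        · exact (hS A hA).2 (mem_powersetCard.2 ⟨hTA, hT2⟩)
    · rintro (⟨k, hk, rfl⟩ | hT)
      · obtain ⟨e, he, hke⟩ := hcov k hk
        have hk1 := (mem_Ico.1 hk).1
        refine ⟨⟨insert_subset h0r (singleton_subset_iff.2 (hsub hk)),
          card_pair (by omega)⟩, insert 0 e, Or.inl ⟨e, he, rfl⟩, ?_⟩
        exact insert_subset_insert _ (singleton_subset_iff.2 hke)
      · obtain ⟨h1, h2⟩ := mem_powersetCard.1 (hH hT)
        exact ⟨⟨h1.trans hsub, h2⟩, insert 0 T, Or.inl ⟨T, hT, rfl⟩, subset_insert _ _⟩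
  have triangles : (powersetCard 3 (range r)).filter
      (fun T => ∃ A ∈ F, T ⊆ A) = F := by
    ext T
    rw [mem_filter, mem_powersetCard]
    constructor
    · rintro ⟨⟨-, hT3⟩, A, hA, hTA⟩
      rwa [eq_of_subset_of_card_le hTA (by rw [hT3, (hFS A hA).2])]
    · exact fun hT => ⟨hFS T hT, T, hT, Subset.rfl⟩
  have card_edges : #((Ico 1 r).image (fun k => ({0, k} : Finset ℕ)) ∪ H) = r - 1 + #H := by
    rw [card_union_of_disjoint, card_image_of_injOn, Nat.card_Ico]
    · intro a ha b hb hab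
      simp only [coe_Ico, Set.mem_Ico] at ha hb
      have : a ∈ ({0, b} : Finset ℕ) := by rw [← show ({0, a} : Finset ℕ) = {0, b} from hab]; simp
      simp at this
      omega
    · rw [disjoint_left]
      intro T hT hTH
      obtain ⟨k, -, rfl⟩ := mem_image.1 hT
      exact hH0 _ hTH (mem_insert_self _ _)
  have card_triangles : #F = #H + #S := by
    subst hF
    rw [card_union_of_disjoint, card_image_of_injOn]
    · intro a ha b hb hab
      rw [← erase_insert (hH0 a ha), ← erase_insert (hH0 b hb)]
      exact congrArg (fun s => s.erase 0) hab
    · rw [disjoint_left]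
      intro T hT hTS
      obtain ⟨e, -, rfl⟩ := mem_image.1 hT
      exact hS0 _ hTS (mem_insert_self _ _)
  refine ⟨range r, F, card_pos.1 (by have := hne.card_pos; omega), hFS, ?_⟩
  intro i hi
  interval_cases i
  · simp [vertices]
  · simp [edges, card_edges]
  · simp [triangles, card_triangles]

/-- An upper estimate for the Macaulay bound in degree one. -/
theorem macaulayBound_one_le (c : ℕ) : macaulayBound 1 c ≤ (c + 1).choose 2 := by
  rcases c with _ | c
  · simp [macaulayBound]
  · simp only [macaulayBound, add_zero]
    exact Nat.choose_le_choose 2 (by simp)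

/-- Every `h`, suitably written as `C(m, 2) + c` with `c < m`, has degree-two Macaulay
bound at most `C(m + 1, 3) + C(c + 1, 2)`. -/
theorem exists_macaulayBound_two_le (h : ℕ) : ∃ m c, c < m ∧ h = m.choose 2 + c ∧
    macaulayBound 2 h ≤ (m + 1).choose 3 + (c + 1).choose 2 := by
  rcases h with _ | n
  · exact ⟨1, 0, by simp [macaulayBound]⟩
  · set m := Nat.findGreatest (fun m => Nat.choose m (1 + 1) ≤ n + 1) (n + 1 + 2) with hm
    have hle : m.choose 2 ≤ n + 1 :=
      Nat.findGreatest_spec (P := fun m => Nat.choose m (1 + 1) ≤ n + 1)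
        (n := n + 1 + 2) (Nat.zero_le _) (by simp)
    have hlt : n + 1 < (m + 1).choose 2 := by
      by_cases hb : m + 1 ≤ n + 1 + 2
      · have := Nat.findGreatest_is_greatest (P := fun m => Nat.choose m (1 + 1) ≤ n + 1)
          (n := n + 1 + 2) (k := m + 1) (by omega) hb
        simpa using this
      · have h1 : (n + 3).choose 2 ≤ (m + 1).choose 2 := Nat.choose_le_choose 2 (by omega)
        have h2 : (n + 3).choose 2 = (n + 2).choose 1 + (n + 2).choose 2 := rfl
        simp at h2
        omega
    have hs : (m + 1).choose 2 = m.choose 1 + m.choose 2 := rfl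
    rw [Nat.choose_one_right] at hs
    refine ⟨m, n + 1 - m.choose 2, by omega, by omega, ?_⟩
    simp only [macaulayBound]
    rw [← hm]
    exact Nat.add_le_add_left (macaulayBound_one_le _) _

open Finset in
/-- A graph on `{1, …, r - 1}` in which `1` is joined to all other vertices, with
`r - 2 + C(m, 2) + c` edges and at least `C(m + 1, 3) + C(c + 1, 2)` triangles. -/
theorem exists_graph_many_triangles {r m c : ℕ} (hcm : c < m) (hmr : m + 2 < r) :
    ∃ H ⊆ powersetCard 2 (Ico 1 r), (∀ k ∈ Ico 2 r, {1, k} ∈ H) ∧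
      #H = r - 2 + (m.choose 2 + c) ∧
      (m + 1).choose 3 + (c + 1).choose 2 ≤
        #((powersetCard 3 (Ico 1 r)).filter (fun t => powersetCard 2 t ⊆ H)) := by
  have hcliq : Ico 1 (m + 2) ⊆ Ico 1 r := Ico_subset_Ico_right (by omega)
  have hnbr : Ico 1 (c + 2) ⊆ Ico 1 (m + 2) := Ico_subset_Ico_right (by omega)
  have hnot : ∀ s ⊆ Ico 1 (m + 2), m + 2 ∉ s := fun s hs hm => by
    have := hs hm
    simp at this
  have hvert : m + 2 ∈ Ico 1 r := by simp; omega
  set A := powersetCard 2 (Ico 1 (m + 2)) with hA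
  set B := (Ico 1 (c + 2)).image (fun k => ({m + 2, k} : Finset ℕ)) with hB
  set C := (Ico (m + 3) r).image (fun k => ({1, k} : Finset ℕ)) with hC
  have hcardA : #A = (m + 1).choose 2 := by rw [hA, card_powersetCard, Nat.card_Ico]; rfl
  have hcardB : #B = c + 1 := by
    rw [hB, card_image_of_injOn, Nat.card_Ico]
    · rfl
    · intro a ha b hb hab
      simp only [coe_Ico, Set.mem_Ico] at ha hb
      have : a ∈ ({m + 2, b} : Finset ℕ) := by
        rw [← show ({m + 2, a} : Finset ℕ) = {m + 2, b} from hab]; simp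
      simp at this
      omega
  have hcardC : #C = r - (m + 3) := by
    rw [hC, card_image_of_injOn, Nat.card_Ico]
    · intro a ha b hb hab
      simp only [coe_Ico, Set.mem_Ico] at ha hb
      have : a ∈ ({1, b} : Finset ℕ) := by
        rw [← show ({1, a} : Finset ℕ) = {1, b} from hab]; simp
      simp at this
      omega
  have hAB : Disjoint A B := by
    rw [disjoint_left]
    intro T hT hTB
    obtain ⟨k, -, rfl⟩ := mem_image.1 hTB
    exact hnot _ (mem_powersetCard.1 hT).1 (mem_insert_self _ _)
  have hABC : Disjoint (A ∪ B) C := by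
    rw [disjoint_left]
    intro T hT hTC
    obtain ⟨k, hk, rfl⟩ := mem_image.1 hTC
    have hk1 := (mem_Ico.1 hk).1
    rcases mem_union.1 hT with hT | hT
    · have : k ∈ Ico 1 (m + 2) := (mem_powersetCard.1 hT).1 (by simp)
      simp at this
      omega
    · obtain ⟨j, hj, hjk⟩ := mem_image.1 hT
      have : k ∈ ({m + 2, j} : Finset ℕ) := by rw [hjk]; simp
      simp at this hj
      omega
  refine ⟨A ∪ B ∪ C, ?_, ?_, ?_, ?_⟩
  · refine union_subset (union_subset (powersetCard_mono hcliq) ?_) ?_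
    · intro T hT
      obtain ⟨k, hk, rfl⟩ := mem_image.1 hT
      have hkm := hnbr hk
      refine mem_powersetCard.2 ⟨insert_subset hvert (singleton_subset_iff.2 (hcliq hkm)),
        card_pair ?_⟩
      simp at hkm
      omega
    · intro T hT
      obtain ⟨k, hk, rfl⟩ := mem_image.1 hT
      rw [mem_Ico] at hk
      refine mem_powersetCard.2 ⟨?_, card_pair (by omega)⟩
      intro x hx
      simp at hx ⊢
      omega
  · intro k hk
    rw [mem_Ico] at hk
    rcases lt_trichotomy k (m + 2) with h | rfl | h
    · refine mem_union_left _ (mem_union_left _ (mem_powersetCard.2 ⟨?_, card_pair (by omega)⟩))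
      intro x hx
      simp at hx ⊢
      omega
    · refine mem_union_left _ (mem_union_right _ (mem_image.2 ⟨1, by simp, pair_comm _ _⟩))
    · exact mem_union_right _ (mem_image.2 ⟨k, by simp; omega, rfl⟩)
  · rw [card_union_of_disjoint hABC, card_union_of_disjoint hAB, hcardA, hcardB, hcardC,
      Nat.choose_succ_succ m 1, Nat.choose_one_right]
    simp only [Nat.succ_eq_add_one, Nat.reduceAdd]
    omega
  · have hsub : powersetCard 3 (Ico 1 (m + 2)) ∪
        (powersetCard 2 (Ico 1 (c + 2))).image (insert (m + 2)) ⊆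
        (powersetCard 3 (Ico 1 r)).filter (fun t => powersetCard 2 t ⊆ A ∪ B ∪ C) := by
      intro t ht
      rw [mem_filter]
      rcases mem_union.1 ht with ht | ht
      · refine ⟨powersetCard_mono hcliq ht, fun e he => ?_⟩
        exact mem_union_left _ (mem_union_left _
          (powersetCard_mono (mem_powersetCard.1 ht).1 he))
      · obtain ⟨p, hp, rfl⟩ := mem_image.1 ht
        obtain ⟨hp1, hp2⟩ := mem_powersetCard.1 hp
        have hpm := hnot p (hp1.trans hnbr)
        refine ⟨mem_powersetCard.2 ⟨insert_subset hvert (hp1.trans (hnbr.trans hcliq)),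
          by rw [card_insert_of_notMem hpm, hp2]⟩, fun e he => mem_union_left _ ?_⟩
        obtain ⟨he1, he2⟩ := mem_powersetCard.1 he
        by_cases hme : m + 2 ∈ e
        · have h1 : #(e.erase (m + 2)) = 1 := by rw [card_erase_of_mem hme, he2]
          obtain ⟨k, hk⟩ := card_eq_one.1 h1
          have hke : k ∈ e.erase (m + 2) := by rw [hk]; exact mem_singleton_self k
          refine mem_union_right _ (mem_image.2 ⟨k, hp1 ?_, ?_⟩)
          · exact mem_of_mem_insert_of_ne (he1 (mem_of_mem_erase hke)) (ne_of_mem_erase hke)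
          · rw [← hk, insert_erase hme]
        · exact mem_union_left _ (mem_powersetCard.2
            ⟨((subset_insert_iff_of_notMem hme).1 he1).trans (hp1.trans hnbr), he2⟩)
    refine le_trans (le_of_eq ?_) (card_le_card hsub)
    rw [card_union_of_disjoint, card_image_of_injOn, card_powersetCard, card_powersetCard,
      Nat.card_Ico, Nat.card_Ico]
    · rfl
    · intro a ha b hb hab
      have ham := hnot a ((mem_powersetCard.1 ha).1.trans hnbr)
      have hbm := hnot b ((mem_powersetCard.1 hb).1.trans hnbr)
      rw [← erase_insert ham, ← erase_insert hbm]
      exact congrArg (fun s => s.erase (m + 2)) hab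
    · rw [disjoint_left]
      intro T hT hTI
      obtain ⟨p, -, rfl⟩ := mem_image.1 hTI
      exact hnot _ (mem_powersetCard.1 hT).1 (mem_insert_self _ _)

open Finset in
/-- If `s ≤ h₂^{<2>}` and `h₂ ≤ h`, then there is a pure f-vector on `r` vertices with
`r - 1 + (r - 2 + h)` edges and `r - 2 + h + s` triangles. -/
theorem isPureFVector_of_le_macaulayBound {r h2 h s : ℕ} (hr : 3 ≤ r)
    (hs : s ≤ macaulayBound 2 h2) (h2h : h2 ≤ h) (hlt : h2 < (r - 2).choose 2)
    (hle : r - 2 + h ≤ (r - 1).choose 2) :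
    IsPureFVector 2 (fun i => if i = 0 then r else if i = 1 then r - 1 + (r - 2 + h)
      else r - 2 + h + s) := by
  obtain ⟨m, c, hcm, hmc, hbound⟩ := exists_macaulayBound_two_le h2
  have hmr : m < r - 2 := by
    by_contra! hge
    have := Nat.choose_le_choose 2 hge
    omega
  obtain ⟨H₀, hH₀, hstar, hcard₀, htri⟩ := exists_graph_many_triangles (r := r) hcm (by omega)
  obtain ⟨H, hsubH, hH, hcard⟩ := exists_subsuperset_card_eq (n := r - 2 + h) hH₀ (by omega)
    (by rw [card_powersetCard, Nat.card_Ico]; exact hle)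
  obtain ⟨S, hS, hcardS⟩ := exists_subset_card_eq (hs.trans (hbound.trans htri))
  rw [← hcard, ← hcardS]
  refine isPureFVector_cone (by omega) hH (card_pos.1 (by omega)) ?_ ?_
  · intro k hk
    rw [mem_Ico] at hk
    rcases Nat.eq_or_lt_of_le hk.1 with rfl | hk1
    · exact ⟨{1, 2}, hsubH (hstar 2 (by simp; omega)), by simp⟩
    · exact ⟨{1, k}, hsubH (hstar k (by simp; omega)), by simp⟩
  · intro t ht
    obtain ⟨h1, h2⟩ := mem_filter.1 (hS ht)
    exact ⟨h1, h2.trans hsubH⟩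

/-- The arithmetic of Steiner triple system parameters. -/
theorem exists_steiner_parameters {r : ℕ} (hr : 7 ≤ r) (hmod : r % 6 = 1 ∨ r % 6 = 3) :
    ∃ T, r.choose 2 = 3 * T ∧ (r - 1) * (r + 6) / 6 = T + (r - 1) ∧ r ≤ T := by
  rcases hmod with h | h
  · obtain ⟨q, rfl⟩ : ∃ q, r = 6 * q + 1 := ⟨r / 6, by omega⟩
    refine ⟨(6 * q + 1) * q, ?_, ?_, by nlinarith⟩
    · rw [Nat.choose_two_right]
      apply Nat.div_eq_of_eq_mul_left (by norm_num)
      simp only [Nat.add_sub_cancel]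
      ring
    · apply Nat.div_eq_of_eq_mul_left (by norm_num)
      simp only [Nat.add_sub_cancel]
      ring
  · obtain ⟨q, rfl⟩ : ∃ q, r = 6 * q + 3 := ⟨r / 6, by omega⟩
    have hsub : 6 * q + 3 - 1 = 6 * q + 2 := by omega
    refine ⟨(2 * q + 1) * (3 * q + 1), ?_, ?_, by nlinarith⟩
    · rw [Nat.choose_two_right, hsub]
      apply Nat.div_eq_of_eq_mul_left (by norm_num)
      ring
    · rw [hsub]
      apply Nat.div_eq_of_eq_mul_left (by norm_num)
      ring

/-- Let `r ≥ 7` be congruent to 1 or 3 mod 6, and `b₀` the smallest positive integer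
`b` such that `(1, r-3, b-2r+3, (r-1)(r+6)/6 - b)` is an O-sequence (of nonnegative
integers, whence `2r - 3 ≤ b ≤ (r-1)(r+6)/6`).  Then `(1, r, b, C(r,2)/3)` is a pure
f-vector for every `b₀ ≤ b ≤ (r-1)(r+6)/6`, and moreover
`0 < b₀ ≤ (r-1)(r+6)/6 < C(r,2) - 1`; hence the Interval Property fails for pure
f-vectors. -/
theorem interval_property_fails (r : ℕ) (hr : 7 ≤ r) (hmod : r % 6 = 1 ∨ r % 6 = 3)
    (b0 : ℕ)
    (hb0 : IsLeast {b : ℕ | 0 < b ∧ 2 * r ≤ b + 3 ∧ b ≤ (r - 1) * (r + 6) / 6 ∧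
      IsOSeq3 (r - 3) (b - (2 * r - 3)) ((r - 1) * (r + 6) / 6 - b)} b0) :
    (∀ b, b0 ≤ b → b ≤ (r - 1) * (r + 6) / 6 →
      IsPureFVector 2
        (fun i => if i = 0 then r else if i = 1 then b else r.choose 2 / 3)) ∧
    0 < b0 ∧ b0 ≤ (r - 1) * (r + 6) / 6 ∧ (r - 1) * (r + 6) / 6 < r.choose 2 - 1 := by
  obtain ⟨⟨hpos, h2r, hle, -, hO⟩, -⟩ := hb0
  obtain ⟨T, hT, hmax, hrT⟩ := exists_steiner_parameters hr hmod
  rw [hmax] at hle hO ⊢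
  refine ⟨fun b hb hbmax => ?_, hpos, hle, by omega⟩
  have hc1 : r.choose 2 = (r - 1) + (r - 1).choose 2 := by
    obtain ⟨n, rfl⟩ : ∃ n, r = n + 1 := ⟨r - 1, by omega⟩
    simp [Nat.choose_succ_succ n 1]
  have hc2 : (r - 1).choose 2 = (r - 2) + (r - 2).choose 2 := by
    obtain ⟨n, rfl⟩ : ∃ n, r = n + 2 := ⟨r - 2, by omega⟩
    simp [Nat.choose_succ_succ n 1]
  have key := isPureFVector_of_le_macaulayBound (r := r) (h2 := b0 - (2 * r - 3))
    (h := b - (2 * r - 3)) (s := T + (r - 1) - b) (by omega)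
    (le_trans (by omega) hO) (by omega) (by omega) (by omega)
  have e1 : r - 1 + (r - 2 + (b - (2 * r - 3))) = b := by omega
  have e2 : r - 2 + (b - (2 * r - 3)) + (T + (r - 1) - b) = r.choose 2 / 3 := by omega
  rwa [e1, e2] at key
end

section
/- For an integer b, the sequence (1, 7, b, 7) is a pure f-vector if and only if b ∈ {12, 13, 14, 15, 16, 17, 18, 19} ∪ {21}. -/
/-- The vertices of the simplicial complex with facets `F`. -/
def facetVertices (F : Finset (Finset ℕ)) : Finset ℕ := F.biUnion id

/-- The edges of the simplicial complex with facets `F`. -/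
def facetEdges (F : Finset (Finset ℕ)) : Finset (Finset ℕ) := F.biUnion (Finset.powersetCard 2)

lemma mem_facetVertices {F : Finset (Finset ℕ)} {v : ℕ} :
    v ∈ facetVertices F ↔ ∃ S ∈ F, v ∈ S := by
  simp [facetVertices]

lemma mem_facetEdges {F : Finset (Finset ℕ)} {e : Finset ℕ} :
    e ∈ facetEdges F ↔ ∃ S ∈ F, e ⊆ S ∧ e.card = 2 := by
  simp [facetEdges, Finset.mem_powersetCard]

lemma pair_mem_facetEdges {F : Finset (Finset ℕ)} {S : Finset ℕ} {v w : ℕ} (hS : S ∈ F)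
    (hv : v ∈ S) (hw : w ∈ S) (h : v ≠ w) : {v, w} ∈ facetEdges F :=
  mem_facetEdges.2 ⟨S, hS, by simp [Finset.insert_subset_iff, hv, hw], Finset.card_pair h⟩

/-- A pure 2-dimensional f-vector is given by the numbers of vertices, edges and members of a
family of triples. -/
lemma isPureFVector_two_iff {f : ℕ → ℕ} :
    IsPureFVector 2 f ↔ ∃ F : Finset (Finset ℕ), F.Nonempty ∧ (∀ S ∈ F, S.card = 3) ∧
      f 0 = (facetVertices F).card ∧ f 1 = (facetEdges F).card ∧ f 2 = F.card := by
  have key : ∀ (V : Finset ℕ) (F : Finset (Finset ℕ)), (∀ S ∈ F, S ⊆ V ∧ S.card = 3) →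
      ((∀ i ≤ 2, f i = ((V.powersetCard (i + 1)).filter (fun T => ∃ S ∈ F, T ⊆ S)).card) ↔
      f 0 = (facetVertices F).card ∧ f 1 = (facetEdges F).card ∧ f 2 = F.card) := by
    intro V F hF
    have h0 : (V.powersetCard (0 + 1)).filter (fun T => ∃ S ∈ F, T ⊆ S) =
        (facetVertices F).image singleton := by
      ext T
      simp only [Finset.mem_filter, Finset.mem_powersetCard, Finset.mem_image,
        mem_facetVertices, zero_add, Finset.card_eq_one]
      constructor
      · rintro ⟨⟨-, a, rfl⟩, S, hS, haS⟩
        exact ⟨a, ⟨S, hS, by simpa using haS⟩, rfl⟩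
      · rintro ⟨a, ⟨S, hS, haS⟩, rfl⟩
        exact ⟨⟨by simpa using (hF S hS).1 haS, a, rfl⟩, S, hS, by simpa using haS⟩
    have h1 : (V.powersetCard (1 + 1)).filter (fun T => ∃ S ∈ F, T ⊆ S) = facetEdges F := by
      ext T
      simp only [Finset.mem_filter, Finset.mem_powersetCard, mem_facetEdges]
      constructor
      · rintro ⟨⟨-, hT⟩, S, hS, hTS⟩
        exact ⟨S, hS, hTS, hT⟩
      · rintro ⟨S, hS, hTS, hT⟩
        exact ⟨⟨hTS.trans (hF S hS).1, hT⟩, S, hS, hTS⟩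
    have h2 : (V.powersetCard (2 + 1)).filter (fun T => ∃ S ∈ F, T ⊆ S) = F := by
      ext T
      simp only [Finset.mem_filter, Finset.mem_powersetCard]
      constructor
      · rintro ⟨⟨-, hT⟩, S, hS, hTS⟩
        rwa [Finset.eq_of_subset_of_card_le hTS (by rw [hT, (hF S hS).2])]
      · exact fun hT => ⟨hF T hT, T, hT, subset_rfl⟩
    have h0' := congrArg Finset.card h0
    rw [Finset.card_image_of_injective _ Finset.singleton_injective] at h0'
    constructor
    · intro h
      exact ⟨(h 0 (by lia)).trans h0', by rw [h 1 (by lia), h1], by rw [h 2 le_rfl, h2]⟩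
    · rintro ⟨e0, e1, e2⟩ i hi
      interval_cases i
      · exact e0.trans h0'.symm
      · rw [e1, h1]
      · rw [e2, h2]
  constructor
  · rintro ⟨V, F, hne, hF, h⟩
    exact ⟨F, hne, fun S hS => (hF S hS).2, (key V F hF).1 h⟩
  · rintro ⟨F, hne, hF, h⟩
    have hF' : ∀ S ∈ F, S ⊆ facetVertices F ∧ S.card = 3 := fun S hS =>
      ⟨Finset.subset_biUnion_of_mem id hS, hF S hS⟩
    exact ⟨facetVertices F, F, hne, hF', (key _ F hF').2 h⟩

lemma card_le_choose_three {F : Finset (Finset ℕ)} (hF : ∀ S ∈ F, S.card = 3) :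
    F.card ≤ (facetVertices F).card.choose 3 := by
  rw [← Finset.card_powersetCard]
  exact Finset.card_le_card fun S hS =>
    Finset.mem_powersetCard.2 ⟨Finset.subset_biUnion_of_mem id hS, hF S hS⟩

lemma facetEdges_subset_powersetCard (F : Finset (Finset ℕ)) :
    facetEdges F ⊆ (facetVertices F).powersetCard 2 := fun e he => by
  obtain ⟨S, hS, heS, he2⟩ := mem_facetEdges.1 he
  exact Finset.mem_powersetCard.2 ⟨heS.trans (Finset.subset_biUnion_of_mem id hS), he2⟩

lemma three_le_card_facetEdges {F : Finset (Finset ℕ)} (hF : ∀ S ∈ F, S.card = 3)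
    (hne : F.Nonempty) : 3 ≤ (facetEdges F).card := by
  obtain ⟨S, hS⟩ := hne
  have : (S.powersetCard 2).card = 3 := by rw [Finset.card_powersetCard, hF S hS]; rfl
  rw [← this]
  exact Finset.card_le_card (Finset.subset_biUnion_of_mem (Finset.powersetCard 2) hS)

lemma card_image_pair {v : ℕ} {W : Finset ℕ} (hv : v ∉ W) :
    (W.image fun x => ({v, x} : Finset ℕ)).card = W.card := by
  refine Finset.card_image_of_injOn fun a ha b hb h => ?_
  have : a ∈ ({v, b} : Finset ℕ) := by
    rw [← show ({v, a} : Finset ℕ) = {v, b} from h]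
    simp
  rcases Finset.mem_insert.1 this with rfl | h'
  · exact absurd ha hv
  · exact Finset.mem_singleton.1 h'

/-- Deleting a vertex `v` contained in the least number `t` of triples: `d` is the number of
neighbours of `v`.  Besides `v`, only vertices contained in the same triples as `v` can
disappear. -/
lemma exists_delete_vertex {F : Finset (Finset ℕ)} (hF : ∀ S ∈ F, S.card = 3)
    (hne : F.Nonempty) :
    ∃ (G : Finset (Finset ℕ)) (t d : ℕ), (∀ S ∈ G, S.card = 3) ∧ 1 ≤ t ∧
      (facetVertices F).card * t ≤ F.card * 3 ∧ G.card + t = F.card ∧ 2 ≤ d ∧ (t = 1 ∨ 3 ≤ d) ∧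
      (((facetVertices G).card + 1 = (facetVertices F).card ∧
          (facetEdges G).card + d ≤ (facetEdges F).card) ∨
        (((facetVertices G).card + 2 = (facetVertices F).card ∨
            (facetVertices G).card + 3 = (facetVertices F).card ∧ t = 1) ∧
          (facetEdges G).card + d + (d - 1) ≤ (facetEdges F).card)) := by
  obtain ⟨S₀, hS₀⟩ := hne
  have hU : (facetVertices F).Nonempty := by
    obtain ⟨a, ha⟩ := Finset.card_pos.1 (by rw [hF S₀ hS₀]; lia : 0 < S₀.card)
    exact ⟨a, mem_facetVertices.2 ⟨S₀, hS₀, ha⟩⟩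
  obtain ⟨v, hvU, hmin⟩ := Finset.exists_min_image (facetVertices F)
    (fun w => (F.filter (fun S => w ∈ S)).card) hU
  set A := F.filter (fun S => v ∈ S)
  set G := F.filter (fun S => v ∉ S)
  set W := facetVertices A
  set L := facetVertices F \ facetVertices G
  have hGF : G ⊆ F := Finset.filter_subset _ _
  have hAF : A ⊆ F := Finset.filter_subset _ _
  obtain ⟨S₁, hS₁, hvS₁⟩ := mem_facetVertices.1 hvU
  have hS₁A : S₁ ∈ A := Finset.mem_filter.2 ⟨hS₁, hvS₁⟩
  have hvW : v ∈ W := mem_facetVertices.2 ⟨S₁, hS₁A, hvS₁⟩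
  have hvG : v ∉ facetVertices G := fun h => by
    obtain ⟨S, hS, hvS⟩ := mem_facetVertices.1 h
    exact (Finset.mem_filter.1 hS).2 hvS
  have hvL : v ∈ L := Finset.mem_sdiff.2 ⟨hvU, hvG⟩
  have hsubW : ∀ S ∈ A, S ⊆ W := fun S hS => Finset.subset_biUnion_of_mem id hS
  have twin : ∀ u ∈ L, ∀ S ∈ A, u ∈ S := by
    intro u hu S hS
    obtain ⟨huU, huG⟩ := Finset.mem_sdiff.1 hu
    have hsub : F.filter (fun S => u ∈ S) ⊆ A := fun T hT => by
      obtain ⟨hTF, huT⟩ := Finset.mem_filter.1 hT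
      by_contra hTA
      exact huG (mem_facetVertices.2 ⟨T, Finset.mem_filter.2
        ⟨hTF, fun hvT => hTA (Finset.mem_filter.2 ⟨hTF, hvT⟩)⟩, huT⟩)
    rw [← Finset.eq_of_subset_of_card_le hsub (hmin u huU)] at hS
    exact (Finset.mem_filter.1 hS).2
  have hLS : ∀ S ∈ A, L ⊆ S := fun S hS u hu => twin u hu S hS
  have hLcard : (facetVertices G).card + L.card = (facetVertices F).card := by
    rw [add_comm]
    exact Finset.card_sdiff_add_card_eq_card (Finset.biUnion_subset_biUnion_of_subset_left _ hGF)
  have hWd : (W.erase v).card + 1 = W.card := Finset.card_erase_add_one hvW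
  have hW3 : 3 ≤ W.card := by
    rw [← hF S₁ hS₁]
    exact Finset.card_le_card (hsubW _ hS₁A)
  have hGE : facetEdges G ⊆ facetEdges F := Finset.biUnion_subset_biUnion_of_subset_left _ hGF
  have star : ∀ u ∈ L, ∀ x ∈ W, x ≠ u → {u, x} ∈ facetEdges F := by
    intro u hu x hx hxu
    obtain ⟨S, hS, hxS⟩ := mem_facetVertices.1 hx
    exact pair_mem_facetEdges (hAF hS) (twin u hu S hS) hxS hxu.symm
  have lost : ∀ u ∈ L, ∀ x, {u, x} ∉ facetEdges G := by
    intro u hu x h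
    obtain ⟨S, hS, hxS, -⟩ := mem_facetEdges.1 h
    exact (Finset.mem_sdiff.1 hu).2 (mem_facetVertices.2 ⟨S, hS, hxS (by simp)⟩)
  set Sv := (W.erase v).image fun x => ({v, x} : Finset ℕ)
  have hSvcard : Sv.card = (W.erase v).card := card_image_pair (by simp)
  have hSvE : Sv ⊆ facetEdges F := by
    intro e he
    obtain ⟨x, hx, rfl⟩ := Finset.mem_image.1 he
    exact star v hvL x (Finset.mem_of_mem_erase hx) (Finset.ne_of_mem_erase hx)
  have hdisj : Disjoint (facetEdges G) Sv := by
    refine Finset.disjoint_right.2 fun e he => ?_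
    obtain ⟨x, -, rfl⟩ := Finset.mem_image.1 he
    exact lost v hvL x
  refine ⟨G, A.card, (W.erase v).card, fun S hS => hF S (hGF hS), Finset.card_pos.2 ⟨S₁, hS₁A⟩,
    ?_, ?_, by lia, ?_, ?_⟩
  · calc (facetVertices F).card * A.card ≤ ∑ S ∈ F, (facetVertices F ∩ S).card :=
          Finset.le_sum_card_inter fun a ha => hmin a ha
      _ ≤ ∑ S ∈ F, 3 := Finset.sum_le_sum fun S hS =>
          (Finset.card_le_card Finset.inter_subset_right).trans (hF S hS).le
      _ = F.card * 3 := by simp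
  · rw [add_comm]
    exact Finset.card_filter_add_card_filter_not _
  · by_contra! h
    obtain ⟨h1, h2⟩ := h
    have : ∀ S ∈ A, S = W := fun S hS =>
      Finset.eq_of_subset_of_card_le (hsubW S hS) (by rw [hF S (hAF hS)]; lia)
    refine h1 (Finset.card_eq_one.2 ⟨W, Finset.eq_singleton_iff_unique_mem.2 ⟨?_, this⟩⟩)
    rwa [← this S₁ hS₁A]
  · have hL1 : 0 < L.card := Finset.card_pos.2 ⟨v, hvL⟩
    have hL3 : L.card ≤ 3 := hF S₁ hS₁ ▸ Finset.card_le_card (hLS S₁ hS₁A)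
    rcases Nat.lt_or_ge 1 L.card with h2 | h2
    · right
      constructor
      · rcases Nat.lt_or_ge 2 L.card with h3 | h3
        · right
          have : ∀ S ∈ A, S = L := fun S hS =>
            (Finset.eq_of_subset_of_card_le (hLS S hS) (by rw [hF S (hAF hS)]; lia)).symm
          refine ⟨by lia, Finset.card_eq_one.2
            ⟨L, Finset.eq_singleton_iff_unique_mem.2 ⟨?_, this⟩⟩⟩
          rwa [← this S₁ hS₁A]
        · left; lia
      · obtain ⟨u, huL, huv⟩ := Finset.exists_mem_ne h2 v
        have huW : u ∈ W := hsubW S₁ hS₁A (twin u huL S₁ hS₁A)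
        set Su := ((W.erase v).erase u).image fun x => ({u, x} : Finset ℕ)
        have hSucard : Su.card = (W.erase v).card - 1 := by
          rw [card_image_pair (by simp),
            Finset.card_erase_of_mem (Finset.mem_erase.2 ⟨huv, huW⟩)]
        have hSuE : Su ⊆ facetEdges F := by
          intro e he
          obtain ⟨x, hx, rfl⟩ := Finset.mem_image.1 he
          exact star u huL x (Finset.mem_of_mem_erase (Finset.mem_of_mem_erase hx))
            (Finset.ne_of_mem_erase hx)
        have hdisj' : Disjoint (facetEdges G ∪ Sv) Su := by
          refine Finset.disjoint_right.2 fun e he he' => ?_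
          obtain ⟨x, hx, rfl⟩ := Finset.mem_image.1 he
          rcases Finset.mem_union.1 he' with h | h
          · exact lost u huL x h
          · obtain ⟨y, -, hy⟩ := Finset.mem_image.1 h
            have : v ∈ ({u, x} : Finset ℕ) := by
              rw [← show ({v, y} : Finset ℕ) = {u, x} from hy]
              simp
            simp only [Finset.mem_insert, Finset.mem_singleton] at this
            rcases this with rfl | rfl
            · exact huv rfl
            · simp at hx
        rw [← hSucard]
        nth_rewrite 1 [← hSvcard]
        rw [← Finset.card_union_of_disjoint hdisj, ← Finset.card_union_of_disjoint hdisj']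
        exact Finset.card_le_card (Finset.union_subset (Finset.union_subset hGE hSvE) hSuE)
    · left
      refine ⟨by lia, ?_⟩
      rw [← hSvcard, ← Finset.card_union_of_disjoint hdisj]
      exact Finset.card_le_card (Finset.union_subset hGE hSvE)

lemma card_facetEdges_of_three_vertices {F : Finset (Finset ℕ)} (hF : ∀ S ∈ F, S.card = 3)
    (hV : (facetVertices F).card ≤ 3) :
    F.card ≤ 1 ∧ ((facetVertices F).card < 3 → F.card = 0) ∧
      (F.card = 1 → 3 ≤ (facetEdges F).card) := by
  have h := card_le_choose_three hF
  refine ⟨h.trans ((Nat.choose_le_choose 3 hV).trans (by decide)), fun h' => ?_, fun h' =>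
    three_le_card_facetEdges hF (Finset.card_pos.1 (by lia))⟩
  rw [Nat.choose_eq_zero_of_lt h'] at h
  lia

lemma card_facetEdges_of_four_vertices {F : Finset (Finset ℕ)} (hF : ∀ S ∈ F, S.card = 3)
    (hV : (facetVertices F).card = 4) :
    2 ≤ F.card ∧ F.card ≤ 4 ∧ 5 ≤ (facetEdges F).card ∧
      (3 ≤ F.card → 6 ≤ (facetEdges F).card) := by
  have h4 := card_le_choose_three hF
  rw [hV, show Nat.choose 4 3 = 4 from rfl] at h4
  have hne : F.Nonempty := by
    rw [Finset.nonempty_iff_ne_empty]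
    rintro rfl
    simp [facetVertices] at hV
  obtain ⟨G, t, d, hG, ht, hk, hn, hd, htd, h⟩ := exists_delete_vertex hF hne
  have := card_facetEdges_of_three_vertices hG (by lia)
  rw [hV] at hk h
  have := hne.card_pos
  lia

lemma card_facetEdges_of_five_vertices {F : Finset (Finset ℕ)} (hF : ∀ S ∈ F, S.card = 3)
    (hV : (facetVertices F).card = 5) (hn6 : F.card ≤ 6) :
    2 ≤ F.card ∧ 6 ≤ (facetEdges F).card ∧ (3 ≤ F.card → 7 ≤ (facetEdges F).card) ∧
      (4 ≤ F.card → 8 ≤ (facetEdges F).card) ∧ (6 ≤ F.card → 9 ≤ (facetEdges F).card) := by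
  have hne : F.Nonempty := by
    rw [Finset.nonempty_iff_ne_empty]
    rintro rfl
    simp [facetVertices] at hV
  obtain ⟨G, t, d, hG, ht, hk, hn, hd, htd, h⟩ := exists_delete_vertex hF hne
  have h3 := card_facetEdges_of_three_vertices hG
  have h4 := card_facetEdges_of_four_vertices hG
  rw [hV] at hk h
  have := hne.card_pos
  lia

lemma card_facetEdges_of_six_vertices {F : Finset (Finset ℕ)} (hF : ∀ S ∈ F, S.card = 3)
    (hV : (facetVertices F).card = 6) (hn4 : 4 ≤ F.card) (hn6 : F.card ≤ 6) :
    9 ≤ (facetEdges F).card ∧ (F.card = 6 → 10 ≤ (facetEdges F).card) := by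
  obtain ⟨G, t, d, hG, ht, hk, hn, hd, htd, h⟩ :=
    exists_delete_vertex hF (Finset.card_pos.1 (by lia))
  have h3 := card_facetEdges_of_three_vertices hG
  have h4 := card_facetEdges_of_four_vertices hG
  have h5 := card_facetEdges_of_five_vertices hG
  rw [hV] at hk h
  lia

lemma card_facetEdges_of_seven_vertices {F : Finset (Finset ℕ)} (hF : ∀ S ∈ F, S.card = 3)
    (hV : (facetVertices F).card = 7) (hn7 : F.card = 7) : 12 ≤ (facetEdges F).card := by
  obtain ⟨G, t, d, hG, ht, hk, hn, hd, htd, h⟩ :=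
    exists_delete_vertex hF (Finset.card_pos.1 (by lia))
  have h4 := card_facetEdges_of_four_vertices hG
  have h5 := card_facetEdges_of_five_vertices hG
  have h6 := card_facetEdges_of_six_vertices hG
  rw [hV] at hk h
  lia

/-- If `{x, y}` is the only non-edge and there are seven vertices, then `x` lies in at least three
triples. -/
lemma three_le_card_filter_mem {F : Finset (Finset ℕ)} (hF : ∀ S ∈ F, S.card = 3)
    (hV : (facetVertices F).card = 7) {x y : ℕ} (hx : x ∈ facetVertices F)
    (hy : y ∈ facetVertices F) (hxy : x ≠ y)
    (hE : ∀ a ∈ facetVertices F, ∀ b ∈ facetVertices F, a ≠ b →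
      ({a, b} : Finset ℕ) ≠ {x, y} → {a, b} ∈ facetEdges F) :
    3 ≤ (F.filter fun S => x ∈ S).card := by
  have hsub : facetVertices F \ {x, y} ⊆ (F.filter fun S => x ∈ S).biUnion fun S => S.erase x := by
    intro z hz
    simp only [Finset.mem_sdiff, Finset.mem_insert, Finset.mem_singleton, not_or] at hz
    obtain ⟨hzV, hzx, hzy⟩ := hz
    have hne : ({x, z} : Finset ℕ) ≠ {x, y} := fun h => by
      have : z ∈ ({x, y} : Finset ℕ) := by rw [← h]; simp
      simp [hzx, hzy] at this
    obtain ⟨S, hS, hsub, -⟩ := mem_facetEdges.1 (hE x hx z hzV (Ne.symm hzx) hne)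
    exact Finset.mem_biUnion.2 ⟨S, Finset.mem_filter.2 ⟨hS, hsub (by simp)⟩,
      Finset.mem_erase.2 ⟨hzx, hsub (by simp)⟩⟩
  have h1 := Finset.card_le_card hsub
  have h2 := Finset.card_biUnion_le_card_mul (F.filter fun S => x ∈ S) (fun S => S.erase x) 2
    fun S hS => by
      obtain ⟨hS, hxS⟩ := Finset.mem_filter.1 hS
      rw [Finset.card_erase_of_mem hxS, hF S hS]
  rw [Finset.card_sdiff_of_subset (by simp [Finset.insert_subset_iff, hx, hy]), hV,
    Finset.card_pair hxy] at h1
  lia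

lemma card_facetEdges_ne_twenty {F : Finset (Finset ℕ)} (hF : ∀ S ∈ F, S.card = 3)
    (hV : (facetVertices F).card = 7) (hn : F.card = 7) : (facetEdges F).card ≠ 20 := by
  intro h20
  have hone : ((facetVertices F).powersetCard 2 \ facetEdges F).card = 1 := by
    rw [Finset.card_sdiff_of_subset (facetEdges_subset_powersetCard F),
      Finset.card_powersetCard, hV, h20]
    rfl
  obtain ⟨e, he⟩ := Finset.card_eq_one.1 hone
  have heV : e ∈ (facetVertices F).powersetCard 2 \ facetEdges F := by simp [he]
  obtain ⟨heV, heE⟩ := Finset.mem_sdiff.1 heV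
  obtain ⟨heV, he2⟩ := Finset.mem_powersetCard.1 heV
  obtain ⟨x, y, hxy, rfl⟩ := Finset.card_eq_two.1 he2
  have hx : x ∈ facetVertices F := heV (by simp)
  have hy : y ∈ facetVertices F := heV (by simp)
  have hE : ∀ f ∈ (facetVertices F).powersetCard 2, f ≠ {x, y} → f ∈ facetEdges F := by
    intro f hf hne
    by_contra hfE
    have : f ∈ (facetVertices F).powersetCard 2 \ facetEdges F := Finset.mem_sdiff.2 ⟨hf, hfE⟩
    rw [he] at this
    exact hne (Finset.mem_singleton.1 this)
  have hE' : ∀ a ∈ facetVertices F, ∀ b ∈ facetVertices F, a ≠ b →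
      ({a, b} : Finset ℕ) ≠ {x, y} → {a, b} ∈ facetEdges F := fun a ha b hb hab hne =>
    hE _ (Finset.mem_powersetCard.2
      ⟨by simp [Finset.insert_subset_iff, ha, hb], Finset.card_pair hab⟩) hne
  have htx := three_le_card_filter_mem hF hV hx hy hxy hE'
  have hty := three_le_card_filter_mem hF hV hy hx hxy.symm
    (by rw [Finset.pair_comm y x]; exact hE')
  have hcover : (facetVertices F \ {x, y}).powersetCard 2 ⊆
      F.biUnion fun S => (S \ {x, y}).powersetCard 2 := by
    intro f hf
    obtain ⟨hfV, hf2⟩ := Finset.mem_powersetCard.1 hf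
    have hfx : x ∉ f := fun h => by simpa using hfV h
    obtain ⟨S, hS, hfS, -⟩ := mem_facetEdges.1 (hE f (Finset.mem_powersetCard.2
      ⟨hfV.trans Finset.sdiff_subset, hf2⟩) (by rintro rfl; simp at hfx))
    exact Finset.mem_biUnion.2 ⟨S, hS, Finset.mem_powersetCard.2
      ⟨fun z hz => Finset.mem_sdiff.2 ⟨hfS hz, (Finset.mem_sdiff.1 (hfV hz)).2⟩, hf2⟩⟩
  have h1 := (Finset.card_le_card hcover).trans Finset.card_biUnion_le
  rw [Finset.card_powersetCard, Finset.card_sdiff_of_subset heV, hV, he2] at h1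
  have h2 : ∀ S ∈ F, ((S \ {x, y}).powersetCard 2).card +
      ((if x ∈ S then 2 else 0) + (if y ∈ S then 2 else 0)) ≤ 3 := by
    intro S hS
    have hS3 := hF S hS
    have hnot : ¬ (x ∈ S ∧ y ∈ S) := fun h => heE (pair_mem_facetEdges hS h.1 h.2 hxy)
    have hcard := Finset.card_sdiff_add_card_inter S {x, y}
    rw [Finset.card_powersetCard]
    by_cases hxS : x ∈ S
    · have hyS : y ∉ S := fun h => hnot ⟨hxS, h⟩
      have hint : S ∩ {x, y} = {x} := by
        ext z; simp only [Finset.mem_inter, Finset.mem_insert, Finset.mem_singleton]; grind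
      rw [hint, Finset.card_singleton, hS3] at hcard
      simp [hxS, hyS, show (S \ {x, y}).card = 2 by lia]
    · by_cases hyS : y ∈ S
      · have hint : S ∩ {x, y} = {y} := by
          ext z; simp only [Finset.mem_inter, Finset.mem_insert, Finset.mem_singleton]; grind
        rw [hint, Finset.card_singleton, hS3] at hcard
        simp [hxS, hyS, show (S \ {x, y}).card = 2 by lia]
      · have := Nat.choose_le_choose 2 (show (S \ {x, y}).card ≤ 3 by lia)
        simpa [hxS, hyS] using this
  have h3 := Finset.sum_le_sum h2
  simp only [Finset.sum_add_distrib, ← Finset.sum_filter, Finset.sum_const, smul_eq_mul, hn]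
    at h3
  rw [show Nat.choose (7 - 2) 2 = 10 from rfl] at h1
  lia

/-- Seven triples on seven vertices with `b` edges. -/
def sevenTriples : ℕ → Finset (Finset ℕ)
  | 12 => {{0, 1, 2}, {0, 1, 3}, {0, 1, 5}, {0, 2, 5}, {0, 2, 6}, {1, 2, 5}, {2, 4, 5}}
  | 13 => {{0, 1, 3}, {1, 2, 3}, {1, 2, 4}, {1, 3, 4}, {1, 4, 6}, {2, 3, 4}, {3, 5, 6}}
  | 14 => {{0, 2, 5}, {1, 2, 4}, {1, 2, 6}, {1, 3, 6}, {2, 3, 5}, {2, 3, 6}, {3, 4, 6}}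
  | 15 => {{0, 1, 2}, {0, 1, 3}, {1, 2, 3}, {1, 2, 4}, {1, 5, 6}, {2, 3, 6}, {2, 4, 5}}
  | 16 => {{0, 1, 6}, {0, 2, 5}, {0, 5, 6}, {1, 2, 3}, {1, 2, 4}, {1, 5, 6}, {3, 4, 5}}
  | 17 => {{0, 1, 2}, {0, 1, 3}, {0, 2, 4}, {0, 5, 6}, {1, 3, 5}, {2, 5, 6}, {3, 4, 6}}
  | 18 => {{0, 1, 5}, {0, 2, 4}, {0, 2, 5}, {0, 3, 6}, {1, 2, 6}, {3, 4, 5}, {4, 5, 6}}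
  | 19 => {{0, 1, 4}, {0, 2, 5}, {0, 2, 6}, {0, 3, 6}, {1, 3, 5}, {2, 3, 4}, {4, 5, 6}}
  | _ => {{0, 1, 2}, {0, 3, 4}, {0, 5, 6}, {1, 3, 5}, {1, 4, 6}, {2, 3, 6}, {2, 4, 5}}

lemma sevenTriples_spec {b : ℕ} (hb : (12 ≤ b ∧ b ≤ 19) ∨ b = 21) :
    (∀ S ∈ sevenTriples b, S.card = 3) ∧ (facetVertices (sevenTriples b)).card = 7 ∧
      (facetEdges (sevenTriples b)).card = b ∧ (sevenTriples b).card = 7 := by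
  have hb' : b ∈ ({12, 13, 14, 15, 16, 17, 18, 19, 21} : Finset ℕ) := by
    simp only [Finset.mem_insert, Finset.mem_singleton]
    lia
  clear hb
  revert b
  set_option maxRecDepth 100000 in decide

/-- `(1, 7, b, 7)` is a pure f-vector if and only if `b ∈ {12, …, 19} ∪ {21}`. -/
theorem pure_fvector_7_b_7_iff (b : ℕ) :
    IsPureFVector 2 (fun i => if i = 0 then 7 else if i = 1 then b else 7) ↔
      ((12 ≤ b ∧ b ≤ 19) ∨ b = 21) := by
  rw [isPureFVector_two_iff]
  simp only [if_true, one_ne_zero, OfNat.ofNat_ne_zero, OfNat.ofNat_ne_one, if_false]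
  constructor
  · rintro ⟨F, -, hF, hV, rfl, hn⟩
    have hle := Finset.card_le_card (facetEdges_subset_powersetCard F)
    rw [Finset.card_powersetCard, ← hV, show Nat.choose 7 2 = 21 from rfl] at hle
    have := card_facetEdges_of_seven_vertices hF hV.symm hn.symm
    have := card_facetEdges_ne_twenty hF hV.symm hn.symm
    lia
  · intro hb
    obtain ⟨hF, hV, hE, hn⟩ := sevenTriples_spec hb
    exact ⟨sevenTriples b, Finset.card_pos.1 (by lia), hF, hV.symm, hE.symm, hn.symm⟩
end
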